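/- If α < α_th, then C_H(A, αA) ≤ sup_p inf_{δ,μ>0} { log V_H − D(p‖q) + Σ_{U∈𝒰} p_U Σ_{ℓ=1}^{nr} log( A·(e^{μδ/A} − e^{−μ(1+δ/A)}) / (√(2πe)·μ·(1 − 2Q(δ/σ_{U,ℓ}))) ) + Σ_{U∈𝒰} p_U Σ_{ℓ=1}^{nr} Q(δ/σ_{U,ℓ}) + Σ_{U∈𝒰} p_U Σ_{ℓ=1}^{nr} (δ/(√(2π)·σ_{U,ℓ}))·e^{−δ²/(2σ_{U,ℓ}²)} + (μ/(A√(2π)))·Σ_{U∈𝒰} p_U Σ_{ℓ=1}^{nr} σ_{U,ℓ}·(e^{−δ²/(2σ_{U,ℓ}²)} − e^{−(A+δ)²/(2σ_{U,ℓ}²)}) + μ·(α − Σ_{U∈𝒰} p_U s_U) }, where the supremum is over all probability vectors p on 𝒰 satisfying Σ_{U∈𝒰} p_U s_U ≤ α. -/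

import Mathlib

open MeasureTheory ProbabilityTheory Matrix Filter Topology
open scoped ENNReal NNReal BigOperators

noncomputable section

namespace MimoOptical

variable {nt nr : ℕ}

/-- The law of a standard Gaussian vector `Z ~ N(0, I_n)` on `ℝ^n`. -/
def stdGaussian (n : ℕ) : Measure (Fin n → ℝ) :=
  Measure.pi fun _ => gaussianReal 0 1

/-- Real-valued Kullback–Leibler divergence `∫ log (dμ/dν) dμ`
(with junk value if not absolutely continuous or not integrable). -/
def klDivR {Ω : Type*} [MeasurableSpace Ω] (μ ν : Measure Ω) : ℝ :=
  ∫ ω, Real.log (μ.rnDeriv ν ω).toReal ∂μ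

/-- Mutual information of a joint law on a product space: the KL divergence between
the joint law and the product of its marginals. -/
def mutualInfoJoint {β γ : Type*} [MeasurableSpace β] [MeasurableSpace γ]
    (π : Measure (β × γ)) : ℝ :=
  klDivR π ((π.map Prod.fst).prod (π.map Prod.snd))

/-- Joint law of `(X, H X + Z)` where `X ~ μ` and `Z ~ N(0, I_nr)` is independent of `X`. -/
def jointLaw (H : Matrix (Fin nr) (Fin nt) ℝ) (μ : Measure (Fin nt → ℝ)) :
    Measure ((Fin nt → ℝ) × (Fin nr → ℝ)) :=
  (μ.prod (stdGaussian nr)).map (fun p => (p.1, H.mulVec p.1 + p.2))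

/-- An admissible input distribution: a probability measure on `[0, A]^nt`
with average power `E[‖X‖₁] ≤ avg`. -/
def Admissible (nt : ℕ) (A avg : ℝ) (μ : Measure (Fin nt → ℝ)) : Prop :=
  IsProbabilityMeasure μ ∧ (∀ᵐ x ∂μ, ∀ k, x k ∈ Set.Icc (0 : ℝ) A) ∧
    (∫ x, ∑ k, |x k| ∂μ) ≤ avg

/-- Capacity of the MIMO optical intensity channel with peak power `A` and
average power `avg`. -/
def capacity (H : Matrix (Fin nr) (Fin nt) ℝ) (A avg : ℝ) : ℝ :=
  sSup { c | ∃ μ : Measure (Fin nt → ℝ),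
    Admissible nt A avg μ ∧ c = mutualInfoJoint (jointLaw H μ) }

/-- The zonotope `R(M) = { M λ : λ ∈ [0,A]^k }`. -/
def zonotope {n k : ℕ} (M : Matrix (Fin n) (Fin k) ℝ) (A : ℝ) : Set (Fin n → ℝ) :=
  { x | ∃ lam : Fin k → ℝ, (∀ i, lam i ∈ Set.Icc 0 A) ∧ x = M.mulVec lam }

/-- The collection `𝒰` of `nr`-element subsets of columns that are linearly independent. -/
def goodSets (H : Matrix (Fin nr) (Fin nt) ℝ) : Set (Finset (Fin nt)) :=
  { U | U.card = nr ∧ LinearIndependent ℝ (fun j : {x // x ∈ U} => fun i => H i j.1) }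

/-- The square matrix `H_U` whose columns are the columns of `H` indexed by `U`
(junk value, the identity, if `U.card ≠ nr`). -/
def HU (H : Matrix (Fin nr) (Fin nt) ℝ) (U : Finset (Fin nt)) :
    Matrix (Fin nr) (Fin nr) ℝ :=
  if h : U.card = nr then H.submatrix id (fun i => U.orderEmbOfFin h i) else 1

/-- `a_{U,j} = 1ᵀ H_U⁻¹ h_j`. -/
def aUj (H : Matrix (Fin nr) (Fin nt) ℝ) (U : Finset (Fin nt)) (j : Fin nt) : ℝ :=
  ∑ i, ((HU H U)⁻¹).mulVec (fun r => H r j) i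

/-- `g_{U,j} = 1` if `a_{U,j} > 1` and `0` otherwise. -/
def gUj (H : Matrix (Fin nr) (Fin nt) ℝ) (U : Finset (Fin nt)) (j : Fin nt) : ℝ :=
  if 1 < aUj H U j then 1 else 0

/-- `s_U = Σ_{j ∈ Uᶜ} g_{U,j}`. -/
def sU (H : Matrix (Fin nr) (Fin nt) ℝ) (U : Finset (Fin nt)) : ℝ :=
  ∑ j ∈ Uᶜ, gUj H U j

/-- `v_U = A Σ_{j ∈ Uᶜ} g_{U,j} h_j`. -/
def vU (H : Matrix (Fin nr) (Fin nt) ℝ) (A : ℝ) (U : Finset (Fin nt)) : Fin nr → ℝ :=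
  fun r => A * ∑ j ∈ Uᶜ, gUj H U j * H r j

/-- The parallelepiped `D_U = R(H_U)`. -/
def DU (H : Matrix (Fin nr) (Fin nt) ℝ) (A : ℝ) (U : Finset (Fin nt)) :
    Set (Fin nr → ℝ) :=
  zonotope (HU H U) A

/-- The shifted parallelepiped `v_U + D_U`. -/
def cell (H : Matrix (Fin nr) (Fin nt) ℝ) (A : ℝ) (U : Finset (Fin nt)) :
    Set (Fin nr → ℝ) :=
  (fun d => vU H A U + d) '' DU H A U

/-- `V_H = Σ_{U ∈ 𝒰} |det H_U|`. -/
def VH (H : Matrix (Fin nr) (Fin nt) ℝ) : ℝ :=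
  ∑ᶠ U ∈ goodSets H, |(HU H U).det|

/-- `q_U = |det H_U| / V_H`. -/
def qU (H : Matrix (Fin nr) (Fin nt) ℝ) (U : Finset (Fin nt)) : ℝ :=
  |(HU H U).det| / VH H

/-- `α_th = nr/2 + Σ_{U ∈ 𝒰} s_U q_U`. -/
def alphaTh (H : Matrix (Fin nr) (Fin nt) ℝ) : ℝ :=
  (nr : ℝ) / 2 + ∑ᶠ U ∈ goodSets H, sU H U * qU H U

/-- A probability vector on `𝒰`. -/
def ProbVec (H : Matrix (Fin nr) (Fin nt) ℝ) (p : Finset (Fin nt) → ℝ) : Prop :=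
  (∀ U, 0 ≤ p U) ∧ (∀ U, U ∉ goodSets H → p U = 0) ∧ (∑ᶠ U ∈ goodSets H, p U) = 1

/-- Kullback–Leibler divergence `D(p‖q)` between probability vectors on `𝒰`. -/
def Dkl (H : Matrix (Fin nr) (Fin nt) ℝ) (p q : Finset (Fin nt) → ℝ) : ℝ :=
  ∑ᶠ U ∈ goodSets H, p U * Real.log (p U / q U)

/-- `σ_{U,ℓ}`: square root of the `ℓ`-th diagonal entry of `H_U⁻¹ (H_U⁻¹)ᵀ`. -/
def sigmaUl (H : Matrix (Fin nr) (Fin nt) ℝ) (U : Finset (Fin nt)) (ℓ : Fin nr) : ℝ :=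
  Real.sqrt ((((HU H U)⁻¹) * ((HU H U)⁻¹)ᵀ) ℓ ℓ)

/-- The trace of the covariance matrix of `X̄ = H X` when `X ~ μ`. -/
def traceCov (H : Matrix (Fin nr) (Fin nt) ℝ) (μ : Measure (Fin nt → ℝ)) : ℝ :=
  ∑ i, ((∫ x, (H.mulVec x i) ^ 2 ∂μ) - (∫ x, H.mulVec x i ∂μ) ^ 2)

/-- The Gaussian Q-function. -/
def Qf (x : ℝ) : ℝ :=
  ∫ t in Set.Ioi x, Real.exp (-t ^ 2 / 2) / Real.sqrt (2 * Real.pi)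

/-- The high-SNR penalty `ν` due to the average-power constraint. -/
def nuVal (H : Matrix (Fin nr) (Fin nt) ℝ) (α : ℝ) : ℝ :=
  sSup { y | ∃ lam mu : ℝ,
    lam ∈ Set.Ioo (max 0 ((nr : ℝ) / 2 + α - alphaTh H)) (min ((nr : ℝ) / 2) α) ∧
    0 < mu ∧
    1 / mu - Real.exp (-mu) / (1 - Real.exp (-mu)) = lam / (nr : ℝ) ∧
    y = (nr : ℝ) * (1 - Real.log (mu / (1 - Real.exp (-mu)))
          - mu * Real.exp (-mu) / (1 - Real.exp (-mu)))
        - sInf { d | ∃ p : Finset (Fin nt) → ℝ, ProbVec H p ∧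
            (∑ᶠ U ∈ goodSets H, p U * sU H U) = α - lam ∧ d = Dkl H p (qU H) } }

end MimoOptical

namespace MimoOptical

section Geometry

variable {nt nr : ℕ}

/-- The coordinates of `H x` in the cell `U`. -/
def lamU (H : Matrix (Fin nr) (Fin nt) ℝ) (A : ℝ) (U : Finset (Fin nt)) (x : Fin nt → ℝ) :
    Fin nr → ℝ :=
  (HU H U)⁻¹ *ᵥ (H *ᵥ x - vU H A U)

theorem HU_eq (H : Matrix (Fin nr) (Fin nt) ℝ) {U : Finset (Fin nt)} (hU : U ∈ goodSets H) :
    HU H U = H.submatrix id (fun i => U.orderEmbOfFin hU.1 i) := by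
  unfold HU
  rw [dif_pos hU.1]

theorem HU_isUnit (H : Matrix (Fin nr) (Fin nt) ℝ) {U : Finset (Fin nt)} (hU : U ∈ goodSets H) :
    IsUnit (HU H U) := by
  rw [← Matrix.linearIndependent_cols_iff_isUnit, HU_eq H hU]
  have h2 := hU.2
  have := h2.comp (fun i : Fin nr => (U.orderIsoOfFin hU.1 i)) (U.orderIsoOfFin hU.1).injective
  exact this

theorem HU_det_isUnit (H : Matrix (Fin nr) (Fin nt) ℝ) {U : Finset (Fin nt)}
    (hU : U ∈ goodSets H) : IsUnit (HU H U).det :=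
  (Matrix.isUnit_iff_isUnit_det _).1 (HU_isUnit H hU)

theorem vecMul_HU (H : Matrix (Fin nr) (Fin nt) ℝ) {U : Finset (Fin nt)} (hU : U ∈ goodSets H)
    (d : Fin nr → ℝ) (l : Fin nr) :
    (d ᵥ* HU H U) l = (d ᵥ* H) (U.orderEmbOfFin hU.1 l) := by
  rw [HU_eq H hU]
  rfl

theorem exists_row (H : Matrix (Fin nr) (Fin nt) ℝ) {U : Finset (Fin nt)} (hU : U ∈ goodSets H)
    (c : Fin nt → ℝ) : ∃ d : Fin nr → ℝ, ∀ k ∈ U, (d ᵥ* H) k = c k := by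
  refine ⟨(fun i => c (U.orderEmbOfFin hU.1 i)) ᵥ* (HU H U)⁻¹, fun k hk => ?_⟩
  have : k ∈ Set.range (U.orderEmbOfFin hU.1) := by
    rw [Finset.range_orderEmbOfFin]; exact hk
  obtain ⟨l, rfl⟩ := this
  rw [← vecMul_HU H hU, vecMul_vecMul, Matrix.nonsing_inv_mul _ (HU_det_isUnit H hU), vecMul_one]

theorem aUj_eq (H : Matrix (Fin nr) (Fin nt) ℝ) {U : Finset (Fin nt)} (hU : U ∈ goodSets H)
    (w : Fin nr → ℝ) (hw : ∀ k ∈ U, (w ᵥ* H) k = 1) (j : Fin nt) :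
    aUj H U j = (w ᵥ* H) j := by
  have h1 : w ᵥ* HU H U = 1 := by
    ext l
    rw [vecMul_HU H hU, hw _ (Finset.orderEmbOfFin_mem _ _ _)]
    rfl
  have h2 : w = 1 ᵥ* (HU H U)⁻¹ := by
    rw [← h1, vecMul_vecMul, Matrix.mul_nonsing_inv _ (HU_det_isUnit H hU), vecMul_one]
  unfold aUj
  have : ∑ i, ((HU H U)⁻¹ *ᵥ fun r => H r j) i = (1 : Fin nr → ℝ) ⬝ᵥ ((HU H U)⁻¹ *ᵥ fun r => H r j) := by
    simp [dotProduct]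
  rw [this, dotProduct_mulVec, ← h2]
  rfl

theorem pair_lam (H : Matrix (Fin nr) (Fin nt) ℝ) (A : ℝ) {U : Finset (Fin nt)}
    (hU : U ∈ goodSets H) (x : Fin nt → ℝ) (d : Fin nr → ℝ) :
    ∑ l, (d ᵥ* H) (U.orderEmbOfFin hU.1 l) * lamU H A U x l
      = ∑ j, (d ᵥ* H) j * x j - A * ∑ j ∈ Uᶜ, gUj H U j * (d ᵥ* H) j := by
  have h1 : HU H U *ᵥ lamU H A U x = H *ᵥ x - vU H A U := by
    unfold lamU
    rw [mulVec_mulVec, Matrix.mul_nonsing_inv _ (HU_det_isUnit H hU), one_mulVec]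
  have h2 : (d ᵥ* HU H U) ⬝ᵥ lamU H A U x = d ⬝ᵥ (H *ᵥ x - vU H A U) := by
    rw [← dotProduct_mulVec, h1]
  have h3 : (d ᵥ* HU H U) ⬝ᵥ lamU H A U x =
      ∑ l, (d ᵥ* H) (U.orderEmbOfFin hU.1 l) * lamU H A U x l := by
    unfold dotProduct
    simp only [vecMul_HU H hU]
  rw [← h3, h2, dotProduct_sub, dotProduct_mulVec]
  congr 1
  unfold vU
  simp only [dotProduct, vecMul]
  simp only [Finset.mul_sum]
  rw [Finset.sum_comm]
  refine Finset.sum_congr rfl fun j _ => Finset.sum_congr rfl fun r _ => by ring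

/-- The power inequality: valid for each `U`, for `x ∈ [0,A]^nt`. -/
theorem power_ineq (H : Matrix (Fin nr) (Fin nt) ℝ) {A : ℝ} {U : Finset (Fin nt)}
    (hU : U ∈ goodSets H) (x : Fin nt → ℝ) (hx : ∀ k, x k ∈ Set.Icc (0 : ℝ) A) :
    ∑ l, lamU H A U x l + A * sU H U ≤ ∑ k, x k := by
  obtain ⟨w, hw⟩ := exists_row H hU (fun _ => 1)
  have h1 := pair_lam H A hU x w
  simp only [hw _ (Finset.orderEmbOfFin_mem _ _ _), one_mul] at h1
  rw [h1, sU, ← Finset.sum_add_sum_compl U, ← Finset.sum_add_sum_compl U x]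
  have h2 : ∑ j ∈ U, (w ᵥ* H) j * x j = ∑ j ∈ U, x j :=
    Finset.sum_congr rfl fun j hj => by rw [hw j hj, one_mul]
  rw [h2]
  have h3 : ∑ j ∈ Uᶜ, ((w ᵥ* H) j * x j - A * (gUj H U j * (w ᵥ* H) j) + A * gUj H U j)
      ≤ ∑ j ∈ Uᶜ, x j := by
    refine Finset.sum_le_sum fun j _ => ?_
    unfold gUj
    rw [aUj_eq H hU w hw]
    obtain ⟨h0, hA⟩ := hx j
    split_ifs with hj
    · nlinarith
    · nlinarith
  simp only [Finset.sum_add_distrib, Finset.sum_sub_distrib, ← Finset.mul_sum] at h3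
  linarith

theorem goodSets_nonempty (H : Matrix (Fin nr) (Fin nt) ℝ) (hrank : H.rank = nr) :
    (goodSets H).Nonempty := by
  classical
  obtain ⟨b, -, -, hb, hli⟩ := exists_linearIndepOn_extension
    (linearIndepOn_empty ℝ H.col) (Set.empty_subset Set.univ)
  have hfin : b.Finite := Set.toFinite b
  refine ⟨hfin.toFinset, ?_, ?_⟩
  · have hspan : Submodule.span ℝ (Set.range (fun j : b => H.col j)) =
        Submodule.span ℝ (Set.range H.col) := by
      have e : Set.range (fun j : b => H.col j) = H.col '' b := by
        ext; simp
      rw [e, ← Set.image_univ]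
      refine le_antisymm (Submodule.span_mono (Set.image_mono (Set.subset_univ _))) ?_
      exact Submodule.span_le.2 hb
    have : Fintype b := hfin.fintype
    have h1 := finrank_span_eq_card hli
    rw [hspan, ← Matrix.rank_eq_finrank_span_cols, hrank] at h1
    rw [h1, ← Set.toFinset_card]
    congr 1
    ext; simp
  · have : LinearIndepOn ℝ H.col (hfin.toFinset : Set (Fin nt)) := by simpa using hli
    exact this

/-- The dual objective. -/
def dualF (A : ℝ) (x c : Fin nt → ℝ) : ℝ := ∑ j, (c j * x j - A * max (c j - 1) 0)

theorem dualF_le {A : ℝ} (x c : Fin nt → ℝ) (hx : ∀ k, x k ∈ Set.Icc (0 : ℝ) A) :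
    dualF A x c ≤ ∑ j, x j := by
  refine Finset.sum_le_sum fun j _ => ?_
  obtain ⟨h0, h1⟩ := hx j
  rcases le_total (c j - 1) 0 with h | h
  · rw [max_eq_right h]; nlinarith
  · rw [max_eq_left h]; nlinarith

theorem exchange (H : Matrix (Fin nr) (Fin nt) ℝ) {U : Finset (Fin nt)} (hU : U ∈ goodSets H)
    {i j : Fin nt} (hi : i ∈ U) (hj : j ∉ U) (d : Fin nr → ℝ)
    (hd : ∀ k ∈ U, k ≠ i → (d ᵥ* H) k = 0) (hdj : (d ᵥ* H) j ≠ 0) :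
    insert j (U.erase i) ∈ goodSets H := by
  have hj' : j ∉ U.erase i := fun h => hj (Finset.mem_of_mem_erase h)
  refine ⟨?_, ?_⟩
  · rw [Finset.card_insert_of_notMem hj', Finset.card_erase_of_mem hi, hU.1]
    have : 0 < U.card := Finset.card_pos.2 ⟨i, hi⟩
    have := hU.1
    omega
  · have h2 : LinearIndepOn ℝ (fun j : Fin nt => fun i => H i j) (U : Set (Fin nt)) := hU.2
    rw [linearIndepOn_finset_iff] at h2
    suffices LinearIndepOn ℝ (fun j : Fin nt => fun i => H i j)
        ((insert j (U.erase i) : Finset (Fin nt)) : Set (Fin nt)) from this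
    rw [linearIndepOn_finset_iff]
    intro f hf
    have h3 : ∑ k ∈ insert j (U.erase i), f k * (d ᵥ* H) k = 0 := by
      have := congrArg (fun v => d ⬝ᵥ v) hf
      simp only [dotProduct_sum, dotProduct_smul, dotProduct_zero] at this
      rw [← this]
      rfl
    rw [Finset.sum_insert hj'] at h3 hf
    have h4 : ∑ k ∈ U.erase i, f k * (d ᵥ* H) k = 0 := by
      refine Finset.sum_eq_zero fun k hk => ?_
      rw [hd k (Finset.mem_of_mem_erase hk) (Finset.ne_of_mem_erase hk), mul_zero]
    rw [h4, add_zero] at h3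
    have hfj : f j = 0 := (mul_eq_zero.1 h3).resolve_right hdj
    rw [hfj, zero_smul, zero_add] at hf
    have h5 := h2 (fun k => if k = i then 0 else f k) (by
      rw [← Finset.add_sum_erase _ _ hi]
      simp only [if_true, zero_smul, zero_add]
      rw [← hf]
      refine Finset.sum_congr rfl fun k hk => ?_
      rw [if_neg (Finset.ne_of_mem_erase hk)])
    intro k hk
    rcases Finset.mem_insert.1 hk with rfl | hk
    · exact hfj
    · have := h5 k (Finset.mem_of_mem_erase hk)
      rwa [if_neg (Finset.ne_of_mem_erase hk)] at this

theorem cover (H : Matrix (Fin nr) (Fin nt) ℝ) (hrank : H.rank = nr) {A : ℝ} (hA : 0 < A)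
    (htie : ∀ U ∈ goodSets H, ∀ j ∉ U, aUj H U j ≠ 1)
    (x : Fin nt → ℝ) (hx : ∀ k, x k ∈ Set.Icc (0 : ℝ) A) :
    ∃ U ∈ goodSets H, ∀ l, lamU H A U x l ∈ Set.Icc (0 : ℝ) A := by
  classical
  obtain ⟨U, hU, hmax⟩ := Set.exists_max_image (goodSets H) (fun U => dualF A x (aUj H U))
    (Set.toFinite _) (goodSets_nonempty H hrank)
  refine ⟨U, hU, fun l => ?_⟩
  by_contra hl
  obtain ⟨w, hw⟩ := exists_row H hU (fun _ => 1)
  have ha : ∀ j, aUj H U j = (w ᵥ* H) j := aUj_eq H hU w hw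
  set i := U.orderEmbOfFin hU.1 l with hi
  have hiU : i ∈ U := Finset.orderEmbOfFin_mem _ _ _
  obtain ⟨ε, hε⟩ : ∃ ε : ℝ, 0 < ε * lamU H A U x l - A * max ε 0 := by
    rw [Set.mem_Icc, not_and_or, not_le, not_le] at hl
    rcases hl with h | h
    · exact ⟨-1, by norm_num; exact h⟩
    · exact ⟨1, by norm_num; exact h⟩
  obtain ⟨d, hd⟩ := exists_row H hU (fun k => if k = i then ε else 0)
  set a := w ᵥ* H with ha'
  set b := d ᵥ* H with hb'
  have hbi : b i = ε := by rw [hd i hiU, if_pos rfl]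
  set s := ε * lamU H A U x l - A * max ε 0 with hs
  -- slope identity
  have hslope : ∑ j, b j * x j - A * ∑ j ∈ Uᶜ, gUj H U j * b j = ε * lamU H A U x l := by
    rw [← pair_lam H A hU x d]
    rw [Finset.sum_eq_single l]
    · rw [← hb', ← hi, hbi]
    · intro k _ hk
      rw [← hb', hd _ (Finset.orderEmbOfFin_mem _ _ _), if_neg, zero_mul]
      intro h
      exact hk ((U.orderEmbOfFin hU.1).injective h)
    · simp
  -- linear growth
  have hgrow : ∀ t : ℝ, 0 ≤ t →
      (∀ j ∉ U, (1 < a j → 1 ≤ a j + t * b j) ∧ (a j < 1 → a j + t * b j ≤ 1)) →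
      dualF A x (a + t • b) = dualF A x a + t * s := by
    intro t ht hsign
    unfold dualF
    simp only [Finset.sum_sub_distrib]
    have e1 : ∑ j, (a + t • b) j * x j = ∑ j, a j * x j + t * ∑ j, b j * x j := by
      rw [Finset.mul_sum, ← Finset.sum_add_distrib]
      exact Finset.sum_congr rfl fun j _ => by simp; ring
    have e2 : ∑ j, A * max ((a + t • b) j - 1) 0 =
        ∑ j, A * max (a j - 1) 0 + t * (A * ∑ j ∈ Uᶜ, gUj H U j * b j) + t * (A * max ε 0) := by
      rw [← Finset.sum_add_sum_compl U, ← Finset.sum_add_sum_compl U (fun j => A * max (a j - 1) 0)]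
      have e3 : ∑ j ∈ U, A * max ((a + t • b) j - 1) 0 = t * (A * max ε 0) := by
        rw [Finset.sum_eq_single i]
        · have : (a + t • b) i - 1 = t * ε := by
            simp [hbi, hw i hiU]
          rw [this]
          have : max (t * ε) 0 = t * max ε 0 := by
            rw [mul_max_of_nonneg _ _ ht, mul_zero]
          rw [this]; ring
        · intro k hk hki
          have : (a + t • b) k - 1 = 0 := by
            simp [hw k hk, hd k hk, hki]
          rw [this]; simp
        · intro h; exact absurd hiU h
      have e4 : ∑ j ∈ U, A * max (a j - 1) 0 = 0 :=
        Finset.sum_eq_zero fun k hk => by rw [hw k hk]; simp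
      have e5 : ∑ j ∈ Uᶜ, A * max ((a + t • b) j - 1) 0 =
          ∑ j ∈ Uᶜ, A * max (a j - 1) 0 + t * (A * ∑ j ∈ Uᶜ, gUj H U j * b j) := by
        rw [Finset.mul_sum, Finset.mul_sum, ← Finset.sum_add_distrib]
        refine Finset.sum_congr rfl fun j hj => ?_
        have hjU : j ∉ U := Finset.mem_compl.1 hj
        have hne := htie U hU j hjU
        rw [ha] at hne
        unfold gUj
        rw [ha]
        have hval : (a + t • b) j = a j + t * b j := rfl
        rw [hval]
        obtain ⟨hs1, hs2⟩ := hsign j hjU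
        rcases lt_or_gt_of_ne hne with h | h
        · rw [if_neg (not_lt.2 h.le), max_eq_right (by linarith [hs2 h]), max_eq_right (by linarith)]
          simp
        · rw [if_pos h, max_eq_left (by linarith [hs1 h]), max_eq_left (by linarith)]
          ring
      rw [e3, e4, e5]; ring
    rw [e1, e2, hs, ← hslope]; ring
  have haF : dualF A x (aUj H U) = dualF A x a := by
    congr 1; funext j; exact ha j
  -- breakpoints
  set J := (Finset.univ.filter fun j => j ∉ U ∧ b j ≠ 0 ∧ 0 < (1 - a j) / b j) with hJ
  rcases J.eq_empty_or_nonempty with hJe | hJne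
  · have hsg : ∀ t : ℝ, 0 ≤ t → dualF A x (a + t • b) = dualF A x a + t * s := by
      intro t ht
      refine hgrow t ht fun j hj => ?_
      have hnot : ¬ (j ∉ U ∧ b j ≠ 0 ∧ 0 < (1 - a j) / b j) := by
        intro h
        have : j ∈ J := by rw [hJ]; simp only [Finset.mem_filter, Finset.mem_univ, true_and]; exact h
        rw [hJe] at this
        simp at this
      push Not at hnot
      have hnot := hnot hj
      constructor
      · intro h
        have : 0 ≤ b j := by
          by_contra hb
          push Not at hb
          have := hnot hb.ne
          have h2 : 0 < (1 - a j) / b j := div_pos_of_neg_of_neg (by linarith) hb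
          linarith
        nlinarith [mul_nonneg ht this]
      · intro h
        have : b j ≤ 0 := by
          by_contra hb
          push Not at hb
          have := hnot hb.ne'
          have h2 : 0 < (1 - a j) / b j := div_pos (by linarith) hb
          linarith
        nlinarith [mul_nonneg ht (neg_nonneg.2 this)]
    have hbd := dualF_le x a hx
    set t := (∑ j, x j - dualF A x a + 1) / s with ht
    have ht0 : 0 ≤ t := div_nonneg (by linarith) hε.le
    have h1 := hsg t ht0
    have h2 := dualF_le x (a + t • b) hx
    have h3 : t * s = ∑ j, x j - dualF A x a + 1 := by
      rw [ht]; field_simp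
    linarith
  · obtain ⟨j, hjJ, hjmin⟩ := Finset.exists_min_image J (fun j => (1 - a j) / b j) hJne
    have hj := (Finset.mem_filter.1 hjJ).2
    obtain ⟨hjU, hbj, htj⟩ := hj
    set t := (1 - a j) / b j with ht
    have hF : dualF A x (a + t • b) = dualF A x a + t * s := by
      refine hgrow t htj.le fun k hk => ?_
      have hmin : b k ≠ 0 → 0 < (1 - a k) / b k → t ≤ (1 - a k) / b k := fun h1 h2 =>
        hjmin k (Finset.mem_filter.2 ⟨Finset.mem_univ _, hk, h1, h2⟩)
      constructor
      · intro h
        rcases le_or_gt 0 (b k) with hb | hb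
        · nlinarith [mul_nonneg htj.le hb]
        · have h2 : 0 < (1 - a k) / b k := div_pos_of_neg_of_neg (by linarith) hb
          have h3 := hmin hb.ne h2
          rw [le_div_iff_of_neg hb] at h3
          linarith
      · intro h
        rcases le_or_gt (b k) 0 with hb | hb
        · nlinarith [mul_nonneg htj.le (neg_nonneg.2 hb)]
        · have h2 : 0 < (1 - a k) / b k := div_pos (by linarith) hb
          have h3 := hmin hb.ne' h2
          rw [le_div_iff₀ hb] at h3
          linarith
    have hU' := exchange H hU hiU hjU d (fun k hk hki => by rw [← hb', hd k hk, if_neg hki]) hbj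
    have hab : (w + t • d) ᵥ* H = a + t • b := by
      rw [Matrix.add_vecMul, Matrix.smul_vecMul]
    have hw' : ∀ k ∈ insert j (U.erase i), ((w + t • d) ᵥ* H) k = 1 := by
      intro k hk
      rw [hab]
      rcases Finset.mem_insert.1 hk with rfl | hk
      · simp only [Pi.add_apply, Pi.smul_apply, smul_eq_mul]
        rw [ht]; field_simp; ring
      · simp [hw k (Finset.mem_of_mem_erase hk), hd k (Finset.mem_of_mem_erase hk),
          Finset.ne_of_mem_erase hk]
    have hfin := hmax _ hU'
    have : dualF A x (aUj H (insert j (U.erase i))) = dualF A x (a + t • b) := by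
      congr 1; funext k
      rw [aUj_eq H hU' _ hw', hab]
    rw [this, haF, hF] at hfin
    nlinarith [mul_pos htj hε]

end Geometry

end MimoOptical

namespace MimoOptical

section Duality

theorem duality {X Y : Type*} [MeasurableSpace X] [MeasurableSpace Y]
    (μ : Measure X) [IsProbabilityMeasure μ] (l : Measure Y) [SFinite l]
    (k : X × Y → ℝ≥0∞) (hk : Measurable k) (C : ℝ≥0∞) (hC : C ≠ ∞) (hkC : ∀ p, k p ≤ C)
    (hk0 : ∀ p, k p ≠ 0) (hk1 : ∀ x, ∫⁻ y, k (x, y) ∂l = 1)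
    (π : Measure (X × Y)) (hπ : π = (μ.prod l).withDensity k)
    (r : Y → ℝ≥0∞) (hr : Measurable r) (hr0 : ∀ y, r y ≠ 0) (hrt : ∀ y, r y ≠ ∞)
    (hr1 : ∫⁻ y, r y ∂l ≤ 1) (G : X × Y → ℝ) (hG : Integrable G π)
    (hle : ∀ᵐ p ∂π, Real.log (k p).toReal - Real.log (r p.2).toReal ≤ G p) :
    mutualInfoJoint π ≤ ∫ p, G p ∂π := by
  set f : Y → ℝ≥0∞ := fun y => ∫⁻ x, k (x, y) ∂μ with hf
  have hfm : Measurable f := hk.lintegral_prod_left'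
  have hfC : ∀ y, f y ≤ C := fun y => by
    calc f y ≤ ∫⁻ _, C ∂μ := lintegral_mono fun x => hkC _
      _ = C := by simp
  have hft : ∀ y, f y ≠ ∞ := fun y => ((hfC y).trans_lt hC.lt_top).ne
  have hf0 : ∀ y, f y ≠ 0 := fun y h => by
    have := (lintegral_eq_zero_iff (μ := μ) (f := fun x => k (x, y)) (by fun_prop)).1 h
    have h2 : ∀ᵐ x ∂μ, False := by
      filter_upwards [this] with x hx using hk0 _ hx
    exact (IsProbabilityMeasure.ne_zero μ) (by simpa using h2)
  have hkt : ∀ p, k p ≠ ∞ := fun p => ((hkC p).trans_lt hC.lt_top).ne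
  have hfst : π.map Prod.fst = μ := by
    ext s hs
    rw [Measure.map_apply measurable_fst hs, hπ, withDensity_apply _ (measurable_fst hs),
      ← Set.prod_univ, setLIntegral_prod _ hk.aemeasurable]
    simp [hk1]
  have hsnd : π.map Prod.snd = l.withDensity f := by
    ext s hs
    rw [Measure.map_apply measurable_snd hs, hπ, withDensity_apply _ (measurable_snd hs),
      ← Set.univ_prod, setLIntegral_prod_symm _ hk.aemeasurable, withDensity_apply _ hs]
    simp [hf]
  have hprob : IsProbabilityMeasure π := by
    constructor
    have : π Set.univ = (π.map Prod.fst) Set.univ := by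
      rw [Measure.map_apply measurable_fst MeasurableSet.univ]; simp
    rw [this, hfst]; simp
  have hprob2 : IsProbabilityMeasure (l.withDensity f) := by
    rw [← hsnd]; exact Measure.isProbabilityMeasure_map measurable_snd.aemeasurable
  set ν := μ.prod (l.withDensity f) with hν
  set ρ : X × Y → ℝ≥0∞ := fun p => k p / f p.2 with hρ
  have hρm : Measurable ρ := by fun_prop
  have hπν : π = ν.withDensity ρ := by
    rw [hν, prod_withDensity_right hfm, ← withDensity_mul _ (by fun_prop) hρm, hπ]
    congr 1
    ext p
    simp only [Pi.mul_apply, hρ]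
    rw [ENNReal.mul_div_cancel (hf0 _) (hft _)]
  have hρ0 : ∀ p, ρ p ≠ 0 := fun p => ENNReal.div_ne_zero.2 ⟨hk0 p, hft _⟩
  have hρt : ∀ p, ρ p ≠ ∞ := fun p => ENNReal.div_ne_top (hkt p) (hf0 _)
  have hrn : π.rnDeriv ν =ᵐ[π] ρ := by
    have h1 : (ν.withDensity ρ).rnDeriv ν =ᵐ[ν] ρ := Measure.rnDeriv_withDensity ν hρm
    rw [← hπν] at h1
    have hac : π ≪ ν := by rw [hπν]; exact withDensity_absolutelyContinuous _ _
    exact hac.ae_le h1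
  unfold mutualInfoJoint klDivR
  rw [hfst, hsnd]
  have e0 : ∫ ω, Real.log (π.rnDeriv ν ω).toReal ∂π = ∫ ω, Real.log (ρ ω).toReal ∂π := by
    refine integral_congr_ae ?_
    filter_upwards [hrn] with p hp
    rw [hp]
  rw [e0]
  -- ratio r / f
  have hi1 : ∫⁻ p, (r p.2 / f p.2) ∂π ≤ 1 := by
    have : ∫⁻ p, (r p.2 / f p.2) ∂π = ∫⁻ y, (r y / f y) ∂(π.map Prod.snd) := by
      rw [lintegral_map (by fun_prop) measurable_snd]
    rw [this, hsnd, lintegral_withDensity_eq_lintegral_mul _ hfm (by fun_prop)]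
    refine le_trans (le_of_eq ?_) hr1
    refine lintegral_congr fun y => ?_
    simp only [Pi.mul_apply]
    rw [ENNReal.mul_div_cancel (hf0 _) (hft _)]
  have hi2 : ∫⁻ p, (ρ p)⁻¹ ∂π ≤ 1 := by
    rw [hπν, lintegral_withDensity_eq_lintegral_mul _ hρm (by fun_prop)]
    have : ∀ p, (ρ * fun p => (ρ p)⁻¹) p = 1 := fun p => by
      simp only [Pi.mul_apply]
      exact ENNReal.mul_inv_cancel (hρ0 p) (hρt p)
    simp [this]
  have hI1 : Integrable (fun p => (r p.2 / f p.2).toReal) π :=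
    integrable_toReal_of_lintegral_ne_top (by fun_prop) (hi1.trans_lt ENNReal.one_lt_top).ne
  have hI2 : Integrable (fun p => ((ρ p)⁻¹).toReal) π :=
    integrable_toReal_of_lintegral_ne_top (by fun_prop) (hi2.trans_lt ENNReal.one_lt_top).ne
  have hup : ∀ᵐ p ∂π, Real.log (ρ p).toReal ≤ G p + ((r p.2 / f p.2).toReal - 1) := by
    filter_upwards [hle] with p hp
    have kp := ENNReal.toReal_pos (hk0 p) (hkt p)
    have fp := ENNReal.toReal_pos (hf0 p.2) (hft p.2)
    have rp := ENNReal.toReal_pos (hr0 p.2) (hrt p.2)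
    have h1 : Real.log (ρ p).toReal = Real.log (k p).toReal - Real.log (f p.2).toReal := by
      simp only [hρ]
      rw [ENNReal.toReal_div, Real.log_div kp.ne' fp.ne']
    have h2 : Real.log (r p.2).toReal - Real.log (f p.2).toReal ≤ (r p.2 / f p.2).toReal - 1 := by
      rw [ENNReal.toReal_div, ← Real.log_div rp.ne' fp.ne']
      exact Real.log_le_sub_one_of_pos (div_pos rp fp)
    linarith
  have hlow : ∀ p, 1 - ((ρ p)⁻¹).toReal ≤ Real.log (ρ p).toReal := by
    intro p
    have h := ENNReal.toReal_pos (hρ0 p) (hρt p)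
    rw [ENNReal.toReal_inv]
    exact Real.one_sub_inv_le_log_of_pos h
  have hGI : Integrable (fun p => G p + ((r p.2 / f p.2).toReal - 1)) π :=
    hG.add (hI1.sub (integrable_const _))
  have hIntG : Integrable (fun p => Real.log (ρ p).toReal) π := by
    refine integrable_of_le_of_le (hρm.ennreal_toReal.log.aestronglyMeasurable) (Eventually.of_forall hlow) hup
      ((integrable_const 1).sub hI2) hGI
  calc ∫ ω, Real.log (ρ ω).toReal ∂π ≤ ∫ p, (G p + ((r p.2 / f p.2).toReal - 1)) ∂π :=
        integral_mono_ae hIntG hGI hup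
    _ = ∫ p, G p ∂π + (∫ p, (r p.2 / f p.2).toReal ∂π - 1) := by
        have h1 := integral_add hG (hI1.sub (integrable_const (μ := π) (1 : ℝ)))
        have h2 := integral_sub hI1 (integrable_const (μ := π) (1 : ℝ))
        simp only [Pi.sub_apply] at h1
        rw [h1, h2]
        simp
    _ ≤ ∫ p, G p ∂π := by
        have : ∫ p, (r p.2 / f p.2).toReal ∂π ≤ 1 := by
          rw [integral_toReal (by fun_prop)
            (Eventually.of_forall fun p => (ENNReal.div_ne_top (hrt _) (hf0 _)).lt_top)]
          exact ENNReal.toReal_le_of_le_ofReal zero_le_one (by simpa using hi1)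
        linarith

end Duality

end MimoOptical

namespace MimoOptical

section OneDim

/-- Centred Gaussian density with standard deviation `σ`. -/
def gpdf (σ x : ℝ) : ℝ := (Real.sqrt (2 * Real.pi) * σ)⁻¹ * Real.exp (-(x ^ 2) / (2 * σ ^ 2))

theorem gpdf_eq {σ : ℝ} (hσ : 0 < σ) (v : ℝ≥0) (hv : (v : ℝ) = σ ^ 2) (x : ℝ) :
    gaussianPDFReal 0 v x = gpdf σ x := by
  unfold gaussianPDFReal gpdf
  rw [hv, Real.sqrt_mul (by positivity), Real.sqrt_sq hσ.le]
  simp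

theorem gpdf_pos {σ : ℝ} (hσ : 0 < σ) (x : ℝ) : 0 < gpdf σ x := by
  unfold gpdf; positivity

theorem gpdf_neg (σ x : ℝ) : gpdf σ (-x) = gpdf σ x := by
  unfold gpdf; simp

theorem gpdf_cont (σ : ℝ) : Continuous (gpdf σ) := by
  unfold gpdf; fun_prop

theorem gpdf_integrable {σ : ℝ} (hσ : 0 < σ) : Integrable (gpdf σ) := by
  have := integrable_gaussianPDFReal 0 ⟨σ ^ 2, sq_nonneg σ⟩
  refine this.congr (Eventually.of_forall fun x => gpdf_eq hσ _ rfl x)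

theorem gpdf_integral {σ : ℝ} (hσ : 0 < σ) : ∫ x, gpdf σ x = 1 := by
  have h0 : (⟨σ ^ 2, sq_nonneg σ⟩ : ℝ≥0) ≠ 0 := by
    intro h
    have h2 : σ ^ 2 = 0 := congrArg NNReal.toReal h
    exact hσ.ne' (pow_eq_zero_iff (two_ne_zero) |>.1 h2)
  rw [← integral_gaussianPDFReal_eq_one 0 h0]
  exact integral_congr_ae (Eventually.of_forall fun x => (gpdf_eq hσ _ rfl x).symm)

theorem integral_gauss {σ : ℝ} (hσ : 0 < σ) (v : ℝ≥0) (hv : (v : ℝ) = σ ^ 2) (f : ℝ → ℝ) :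
    ∫ x, f x ∂(gaussianReal 0 v) = ∫ x, gpdf σ x * f x := by
  have h0 : v ≠ 0 := by
    rintro rfl
    have h2 : 0 < σ ^ 2 := by positivity
    rw [← hv] at h2
    simp at h2
  rw [integral_gaussianReal_eq_integral_smul h0]
  simp only [gpdf_eq hσ v hv, smul_eq_mul]

theorem Qf_eq {σ : ℝ} (hσ : 0 < σ) (δ : ℝ) : Qf (δ / σ) = ∫ x in Set.Ioi δ, gpdf σ x := by
  unfold Qf
  have h := integral_comp_mul_left_Ioi
    (fun t => Real.exp (-t ^ 2 / 2) / Real.sqrt (2 * Real.pi)) δ (inv_pos.2 hσ)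
  rw [show δ / σ = σ⁻¹ * δ by ring]
  rw [inv_inv, smul_eq_mul] at h
  rw [show ∫ (x : ℝ) in Set.Ioi (σ⁻¹ * δ), Real.exp (-x ^ 2 / 2) / Real.sqrt (2 * Real.pi) =
    σ⁻¹ * (σ * ∫ (x : ℝ) in Set.Ioi (σ⁻¹ * δ), Real.exp (-x ^ 2 / 2) / Real.sqrt (2 * Real.pi)) by
      field_simp, ← h, ← integral_const_mul]
  refine integral_congr_ae (Eventually.of_forall fun x => ?_)
  simp only [gpdf]
  have : -(σ⁻¹ * x) ^ 2 / 2 = -(x ^ 2) / (2 * σ ^ 2) := by field_simp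
  rw [this, mul_inv]
  ring

theorem Qf_eq_left {σ : ℝ} (hσ : 0 < σ) (δ : ℝ) : ∫ x in Set.Iic (-δ), gpdf σ x = Qf (δ / σ) := by
  rw [Qf_eq hσ, ← integral_comp_neg_Ioi]
  simp only [gpdf_neg]

theorem Qf_nonneg {σ : ℝ} (hσ : 0 < σ) (δ : ℝ) : 0 ≤ Qf (δ / σ) := by
  rw [Qf_eq hσ]
  exact integral_nonneg fun x => (gpdf_pos hσ x).le

/-- Central mass. -/
theorem central {σ : ℝ} (hσ : 0 < σ) (δ : ℝ) :
    ∫ x in (-δ)..δ, gpdf σ x = 1 - 2 * Qf (δ / σ) := by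
  have hi := gpdf_integrable hσ
  have h1 := intervalIntegral.integral_Iic_add_Ioi (b := δ) hi.integrableOn hi.integrableOn
  have h2 := intervalIntegral.integral_Iic_sub_Iic (a := -δ) (b := δ) hi.integrableOn
    hi.integrableOn
  rw [gpdf_integral hσ, ← Qf_eq hσ] at h1
  rw [Qf_eq_left hσ] at h2
  linarith

theorem central_pos {σ δ : ℝ} (hσ : 0 < σ) (hδ : 0 < δ) : 0 < 1 - 2 * Qf (δ / σ) := by
  rw [← central hσ]
  exact intervalIntegral.intervalIntegral_pos_of_pos ((gpdf_cont σ).intervalIntegrable _ _)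
    (gpdf_pos hσ) (by linarith)

theorem central_le {σ δ : ℝ} (hσ : 0 < σ) (hδ : 0 < δ) :
    1 - 2 * Qf (δ / σ) ≤ (Real.sqrt (2 * Real.pi) * σ)⁻¹ * (2 * δ) := by
  rw [← central hσ]
  have h := intervalIntegral.norm_integral_le_of_norm_le_const
    (f := gpdf σ) (a := -δ) (b := δ) (C := (Real.sqrt (2 * Real.pi) * σ)⁻¹) (by
      intro x _
      rw [Real.norm_of_nonneg (gpdf_pos hσ x).le]
      unfold gpdf
      refine mul_le_of_le_one_right (by positivity) ?_
      rw [Real.exp_le_one_iff]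
      exact div_nonpos_of_nonpos_of_nonneg (by nlinarith [sq_nonneg x]) (by positivity))
  rw [show δ - -δ = 2 * δ by ring, abs_of_pos (by linarith)] at h
  exact (le_abs_self _).trans h

/-- Normalisation constant of the truncated exponential part. -/
def Econst (A δ m σ : ℝ) : ℝ :=
  A * (Real.exp (m * δ / A) - Real.exp (-(m * (1 + δ / A)))) / (m * (1 - 2 * Qf (δ / σ)))

theorem expdiff {A δ m : ℝ} (hA : 0 < A) (hδ : 0 < δ) (hm : 0 < m) :
    2 * δ * m ≤ A * (Real.exp (m * δ / A) - Real.exp (-(m * (1 + δ / A)))) := by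
  set u := m * δ / A with hu
  have hu0 : 0 < u := by positivity
  have h1 : Real.exp (-(m * (1 + δ / A))) ≤ Real.exp (-u) := by
    rw [Real.exp_le_exp, hu]
    have : m * (1 + δ / A) = m + m * δ / A := by ring
    linarith
  have h2 : u ≤ Real.sinh u := Real.self_le_sinh_iff.2 hu0.le
  rw [Real.sinh_eq] at h2
  have h3 : δ * m = A * u := by rw [hu]; field_simp
  nlinarith

theorem le_Econst {A δ m σ : ℝ} (hA : 0 < A) (hδ : 0 < δ) (hm : 0 < m) (hσ : 0 < σ) :
    Real.sqrt (2 * Real.pi) * σ ≤ Econst A δ m σ := by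
  have hP := central_pos hσ hδ
  have hP2 := central_le hσ hδ
  have hE := expdiff hA hδ hm
  have hs : 0 < Real.sqrt (2 * Real.pi) * σ := by positivity
  unfold Econst
  rw [le_div_iff₀ (by positivity)]
  refine le_trans ?_ hE
  rw [inv_mul_eq_div, le_div_iff₀ hs] at hP2
  nlinarith

theorem Econst_pos {A δ m σ : ℝ} (hA : 0 < A) (hδ : 0 < δ) (hm : 0 < m) (hσ : 0 < σ) :
    0 < Econst A δ m σ :=
  lt_of_lt_of_le (by positivity) (le_Econst hA hδ hm hσ)

/-- The auxiliary output density. -/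
def fd (A δ m σ y : ℝ) : ℝ :=
  if y ≤ -δ then gpdf σ y else
    if y ≤ A + δ then Real.exp (-(m * y / A)) / Econst A δ m σ else gpdf σ (y - A)

theorem fd_pos {A δ m σ : ℝ} (hA : 0 < A) (hδ : 0 < δ) (hm : 0 < m) (hσ : 0 < σ) (y : ℝ) :
    0 < fd A δ m σ y := by
  unfold fd
  split_ifs
  · exact gpdf_pos hσ _
  · exact div_pos (Real.exp_pos _) (Econst_pos hA hδ hm hσ)
  · exact gpdf_pos hσ _

theorem fd_measurable (A δ m σ : ℝ) : Measurable (fd A δ m σ) := by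
  unfold fd
  refine Measurable.ite measurableSet_Iic (gpdf_cont σ).measurable ?_
  refine Measurable.ite measurableSet_Iic (by fun_prop) ?_
  exact ((gpdf_cont σ).comp (continuous_id.sub continuous_const)).measurable

theorem integral_exp_part {A δ m : ℝ} (hA : 0 < A) (hm : 0 < m) :
    ∫ y in (-δ)..(A + δ), Real.exp (-(m * y / A)) =
      A * (Real.exp (m * δ / A) - Real.exp (-(m * (1 + δ / A)))) / m := by
  have h := intervalIntegral.integral_eq_sub_of_hasDerivAt
    (f := fun y => -(A / m) * Real.exp (-(m * y / A)))
    (f' := fun y => Real.exp (-(m * y / A))) (a := -δ) (b := A + δ) (by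
      intro y _
      have h1 : HasDerivAt (fun y : ℝ => -(m * y / A)) (-(m * 1 / A)) y :=
        (((hasDerivAt_id y).const_mul m).div_const A).neg
      have h2 := (h1.exp).const_mul (-(A / m))
      exact h2.congr_deriv (by field_simp)) ((by fun_prop : Continuous fun y : ℝ => Real.exp (-(m * y / A))).intervalIntegrable _ _)
  rw [h]
  have e1 : -(m * (A + δ) / A) = -(m * (1 + δ / A)) := by field_simp
  have e2 : -(m * -δ / A) = m * δ / A := by field_simp
  rw [e1, e2]
  field_simp
  ring

theorem fd_lintegral {A δ m σ : ℝ} (hA : 0 < A) (hδ : 0 < δ) (hm : 0 < m) (hσ : 0 < σ) :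
    ∫⁻ y, ENNReal.ofReal (fd A δ m σ y) ≤ 1 := by
  have hi := gpdf_integrable hσ
  have hE := Econst_pos hA hδ hm hσ
  have hQ := Qf_nonneg hσ δ
  have hP := central_pos hσ hδ
  have hcont : Continuous fun y : ℝ => Real.exp (-(m * y / A)) / Econst A δ m σ := by fun_prop
  have hpt : ∀ y, ENNReal.ofReal (fd A δ m σ y) =
      (Set.Iic (-δ)).indicator (fun y => ENNReal.ofReal (gpdf σ y)) y +
      ((Set.Ioc (-δ) (A + δ)).indicator
        (fun y => ENNReal.ofReal (Real.exp (-(m * y / A)) / Econst A δ m σ)) y +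
      (Set.Ioi (A + δ)).indicator (fun y => ENNReal.ofReal (gpdf σ (y - A))) y) := by
    intro y
    unfold fd
    simp only [Set.indicator_apply, Set.mem_Iic, Set.mem_Ioc, Set.mem_Ioi]
    split_ifs <;> first | (exfalso; grind) | simp
  simp only [hpt]
  have hm1 : Measurable fun y => ENNReal.ofReal (gpdf σ y) := (gpdf_cont σ).measurable.ennreal_ofReal
  have hm3 : Measurable fun y => ENNReal.ofReal (gpdf σ (y - A)) :=
    hm1.comp (measurable_id.sub_const A)
  have hm2 : Measurable fun y => ENNReal.ofReal (Real.exp (-(m * y / A)) / Econst A δ m σ) :=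
    hcont.measurable.ennreal_ofReal
  rw [lintegral_add_left (hm1.indicator measurableSet_Iic),
    lintegral_add_left (hm2.indicator measurableSet_Ioc), lintegral_indicator measurableSet_Iic,
    lintegral_indicator measurableSet_Ioc, lintegral_indicator measurableSet_Ioi]
  have h1 : ∫⁻ y in Set.Iic (-δ), ENNReal.ofReal (gpdf σ y) = ENNReal.ofReal (Qf (δ / σ)) := by
    rw [← Qf_eq_left hσ, ofReal_integral_eq_lintegral_ofReal hi.integrableOn
      (Eventually.of_forall fun x => (gpdf_pos hσ x).le)]
  have h3 : ∫⁻ y in Set.Ioi (A + δ), ENNReal.ofReal (gpdf σ (y - A)) =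
      ENNReal.ofReal (Qf (δ / σ)) := by
    rw [← ofReal_integral_eq_lintegral_ofReal (hi.comp_sub_right A).integrableOn
      (Eventually.of_forall fun x => (gpdf_pos hσ _).le)]
    congr 1
    rw [Qf_eq hσ]
    have h := (measurePreserving_sub_right volume A).setIntegral_preimage_emb
      (measurableEmbedding_subRight A) (gpdf σ) (Set.Ioi δ)
    rw [← h]
    congr 2
    ext y
    simp [lt_sub_iff_add_lt, add_comm]
  have h2 : ∫⁻ y in Set.Ioc (-δ) (A + δ),
      ENNReal.ofReal (Real.exp (-(m * y / A)) / Econst A δ m σ) =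
      ENNReal.ofReal (1 - 2 * Qf (δ / σ)) := by
    rw [← ofReal_integral_eq_lintegral_ofReal]
    · congr 1
      rw [← intervalIntegral.integral_of_le (by linarith), intervalIntegral.integral_div,
        integral_exp_part hA hm]
      have hpos : 0 < A * (Real.exp (m * δ / A) - Real.exp (-(m * (1 + δ / A)))) :=
        lt_of_lt_of_le (by positivity) (expdiff hA hδ hm)
      unfold Econst
      set W := A * (Real.exp (m * δ / A) - Real.exp (-(m * (1 + δ / A)))) with hW
      field_simp
    · exact (hcont.integrableOn_Icc).mono_set Set.Ioc_subset_Icc_self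
    · exact Eventually.of_forall fun y => by
        simp only [Pi.zero_apply]; positivity
  rw [h1, h2, h3, ← ENNReal.ofReal_add hP.le hQ, ← ENNReal.ofReal_add hQ (by linarith)]
  refine ENNReal.ofReal_le_one.2 (by linarith)

/-- Pointwise upper bound on `-log fd (x + z)`. -/
def Tb (A δ m σ x z : ℝ) : ℝ :=
  Real.log (Econst A δ m σ) + m / A * x
    + m / A * (Set.Ioc (-δ - x) (A + δ - x)).indicator id z
    + (Set.Ioc (-δ) δ)ᶜ.indicator (fun z => z ^ 2 / (2 * σ ^ 2)) z

theorem neg_log_gpdf {σ : ℝ} (hσ : 0 < σ) (y : ℝ) :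
    -Real.log (gpdf σ y) = Real.log (Real.sqrt (2 * Real.pi) * σ) + y ^ 2 / (2 * σ ^ 2) := by
  unfold gpdf
  rw [Real.log_mul (by positivity) (Real.exp_pos _).ne', Real.log_exp, Real.log_inv]
  ring

theorem neg_log_fd_le {A δ m σ : ℝ} (hA : 0 < A) (hδ : 0 < δ) (hm : 0 < m) (hσ : 0 < σ)
    {x : ℝ} (hx : x ∈ Set.Icc (0 : ℝ) A) (z : ℝ) :
    -Real.log (fd A δ m σ (x + z)) ≤ Tb A δ m σ x z := by
  obtain ⟨hx0, hxA⟩ := hx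
  have hE := Econst_pos hA hδ hm hσ
  have hL : Real.log (Real.sqrt (2 * Real.pi) * σ) ≤ Real.log (Econst A δ m σ) :=
    Real.log_le_log (by positivity) (le_Econst hA hδ hm hσ)
  have hmx : 0 ≤ m / A * x := by positivity
  unfold fd Tb
  split_ifs with h1 h2
  · rw [neg_log_gpdf hσ, Set.indicator_of_notMem (by simp only [Set.mem_Ioc]; intro h; linarith [h.1]),
      Set.indicator_of_mem (by simp only [Set.mem_compl_iff, Set.mem_Ioc]; intro h; linarith [h.1])]
    have : (x + z) ^ 2 / (2 * σ ^ 2) ≤ z ^ 2 / (2 * σ ^ 2) := by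
      gcongr ?_ / _
      nlinarith
    linarith
  · rw [Set.indicator_of_mem (by simp only [Set.mem_Ioc]; constructor <;> linarith),
      Real.log_div (Real.exp_pos _).ne' hE.ne', Real.log_exp]
    have h3 : 0 ≤ (Set.Ioc (-δ) δ)ᶜ.indicator (fun z => z ^ 2 / (2 * σ ^ 2)) z :=
      Set.indicator_nonneg (fun _ _ => by positivity) _
    have h4 : m * (x + z) / A = m / A * x + m / A * z := by ring
    simp only [id]
    linarith
  · rw [neg_log_gpdf hσ, Set.indicator_of_notMem (by simp only [Set.mem_Ioc]; intro h; linarith [h.2]),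
      Set.indicator_of_mem (by simp only [Set.mem_compl_iff, Set.mem_Ioc]; intro h; linarith [h.2])]
    have : (x + z - A) ^ 2 / (2 * σ ^ 2) ≤ z ^ 2 / (2 * σ ^ 2) := by
      gcongr ?_ / _
      nlinarith
    linarith

theorem gpdf_hasDeriv {σ : ℝ} (hσ : 0 < σ) (x : ℝ) :
    HasDerivAt (gpdf σ) (-(x / σ ^ 2) * gpdf σ x) x := by
  have h1 : HasDerivAt (fun x : ℝ => -(x ^ 2) / (2 * σ ^ 2)) (-(2 * x) / (2 * σ ^ 2)) x := by
    have := ((hasDerivAt_pow 2 x).neg).div_const (2 * σ ^ 2)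
    simpa using this
  have h2 := (h1.exp).const_mul ((Real.sqrt (2 * Real.pi) * σ)⁻¹)
  refine h2.congr_deriv ?_
  unfold gpdf
  field_simp

theorem integral_z {σ : ℝ} (hσ : 0 < σ) (a b : ℝ) :
    ∫ z in a..b, gpdf σ z * z = σ ^ 2 * (gpdf σ a - gpdf σ b) := by
  have h := intervalIntegral.integral_eq_sub_of_hasDerivAt
    (f := fun y => -(σ ^ 2) * gpdf σ y) (f' := fun z => gpdf σ z * z) (a := a) (b := b) (by
      intro y _
      have h2 := (gpdf_hasDeriv hσ y).const_mul (-(σ ^ 2))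
      exact h2.congr_deriv (by field_simp)) (((gpdf_cont σ).mul continuous_id).intervalIntegrable _ _)
  rw [h]; ring

theorem integral_z2 {σ : ℝ} (hσ : 0 < σ) (δ : ℝ) :
    ∫ z in (-δ)..δ, gpdf σ z * (z ^ 2 / (2 * σ ^ 2)) =
      (1 - 2 * Qf (δ / σ)) / 2 - δ * gpdf σ δ := by
  have h := intervalIntegral.integral_eq_sub_of_hasDerivAt
    (f := fun y => -(y * gpdf σ y) / 2)
    (f' := fun z => gpdf σ z * (z ^ 2 / (2 * σ ^ 2)) - gpdf σ z / 2) (a := -δ) (b := δ) (by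
      intro y _
      have h2 := (((hasDerivAt_id y).mul (gpdf_hasDeriv hσ y)).neg).div_const 2
      refine h2.congr_deriv ?_
      simp only [id, one_mul]
      field_simp
      ring) (by
        refine Continuous.intervalIntegrable ?_ _ _
        have := gpdf_cont σ
        fun_prop)
  have hc := gpdf_cont σ
  rw [intervalIntegral.integral_sub (Continuous.intervalIntegrable (by fun_prop) _ _)
    (Continuous.intervalIntegrable (by fun_prop) _ _), intervalIntegral.integral_div,
    central hσ, gpdf_neg] at h
  linarith

theorem gauss_sq_integrable (v : ℝ≥0) : Integrable (fun z : ℝ => z ^ 2) (gaussianReal 0 v) := by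
  have := memLp_id_gaussianReal (μ := 0) (v := v) 2
  exact this.integrable_sq

theorem gauss_sq_integral (v : ℝ≥0) : ∫ z, z ^ 2 ∂(gaussianReal 0 v) = v := by
  have h := variance_id_gaussianReal (μ := 0) (v := v)
  rw [variance_of_integral_eq_zero (by fun_prop) (by simp)] at h
  simpa using h

theorem Tb_measurable (A δ m σ : ℝ) : Measurable fun p : ℝ × ℝ => Tb A δ m σ p.1 p.2 := by
  unfold Tb
  have h1 : Measurable fun p : ℝ × ℝ => (Set.Ioc (-δ - p.1) (A + δ - p.1)).indicator id p.2 := by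
    have hs : MeasurableSet {p : ℝ × ℝ | p.2 ∈ Set.Ioc (-δ - p.1) (A + δ - p.1)} := by
      simp only [Set.mem_Ioc, Set.ofPred_and]
      exact (measurableSet_lt (by fun_prop) (by fun_prop)).inter
        (measurableSet_le (by fun_prop) (by fun_prop))
    have := (measurable_snd (α := ℝ) (β := ℝ)).indicator hs
    exact this
  have h2 : Measurable fun p : ℝ × ℝ =>
      (Set.Ioc (-δ) δ)ᶜ.indicator (fun z => z ^ 2 / (2 * σ ^ 2)) p.2 :=
    ((by fun_prop : Measurable fun z : ℝ => z ^ 2 / (2 * σ ^ 2)).indicator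
      measurableSet_Ioc.compl).comp measurable_snd
  fun_prop

theorem Tb_abs_le {A δ m σ : ℝ} (hA : 0 < A) (hm : 0 < m)
    {x : ℝ} (hx : x ∈ Set.Icc (0 : ℝ) A) (z : ℝ) :
    |Tb A δ m σ x z| ≤ |Real.log (Econst A δ m σ)| + m + m / A * (1 + z ^ 2)
      + z ^ 2 / (2 * σ ^ 2) := by
  obtain ⟨hx0, hxA⟩ := hx
  unfold Tb
  have h1 : |m / A * x| ≤ m := by
    rw [abs_of_nonneg (by positivity), div_mul_eq_mul_div, div_le_iff₀ hA]
    nlinarith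
  have h2 : |m / A * (Set.Ioc (-δ - x) (A + δ - x)).indicator id z| ≤ m / A * (1 + z ^ 2) := by
    rw [abs_mul, abs_of_pos (by positivity : 0 < m / A)]
    gcongr
    have hz : |z| ≤ 1 + z ^ 2 := by
      rw [← sq_abs]; nlinarith [sq_nonneg (|z| - 1)]
    rw [Set.indicator_apply]
    split_ifs
    · exact hz
    · rw [abs_zero]; positivity
  have h3 : |(Set.Ioc (-δ) δ)ᶜ.indicator (fun z => z ^ 2 / (2 * σ ^ 2)) z| ≤ z ^ 2 / (2 * σ ^ 2) := by
    rw [Set.indicator_apply]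
    split_ifs
    · rw [abs_of_nonneg (by positivity)]
    · rw [abs_zero]; positivity
  refine (abs_add_le _ _).trans (add_le_add ((abs_add_le _ _).trans (add_le_add
    ((abs_add_le _ _).trans (add_le_add le_rfl h1)) h2)) h3)

/-- The constant term of the one-dimensional bound. -/
def Kb (A δ m σ : ℝ) : ℝ :=
  Qf (δ / σ) + δ / (Real.sqrt (2 * Real.pi) * σ) * Real.exp (-(δ ^ 2) / (2 * σ ^ 2))
    + m / (A * Real.sqrt (2 * Real.pi)) * (σ * (Real.exp (-(δ ^ 2) / (2 * σ ^ 2))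
      - Real.exp (-((A + δ) ^ 2) / (2 * σ ^ 2))))

theorem Tb_integral_le {A δ m σ : ℝ} (hA : 0 < A) (hδ : 0 < δ) (hm : 0 < m) (hσ : 0 < σ)
    (v : ℝ≥0) (hv : (v : ℝ) = σ ^ 2) {x : ℝ} (hx : x ∈ Set.Icc (0 : ℝ) A) :
    ∫ z, Tb A δ m σ x z ∂(gaussianReal 0 v) ≤
      Real.log (Econst A δ m σ) + m / A * x + Kb A δ m σ := by
  obtain ⟨hx0, hxA⟩ := hx
  have hsq := gauss_sq_integrable v
  have hid : Integrable (fun z : ℝ => z) (gaussianReal 0 v) :=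
    (memLp_id_gaussianReal (μ := 0) (v := v) 1).integrable (by simp)
  have hi1 : Integrable (fun z => (Set.Ioc (-δ - x) (A + δ - x)).indicator id z)
      (gaussianReal 0 v) := hid.indicator measurableSet_Ioc
  have hi2 : Integrable (fun z => (Set.Ioc (-δ) δ)ᶜ.indicator (fun z => z ^ 2 / (2 * σ ^ 2)) z)
      (gaussianReal 0 v) := (hsq.div_const _).indicator measurableSet_Ioc.compl
  have e1 : ∫ z, (Set.Ioc (-δ - x) (A + δ - x)).indicator id z ∂(gaussianReal 0 v) =
      σ ^ 2 * (gpdf σ (-δ - x) - gpdf σ (A + δ - x)) := by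
    rw [integral_gauss hσ v hv, ← integral_z hσ, intervalIntegral.integral_of_le (by linarith),
      ← integral_indicator measurableSet_Ioc]
    refine integral_congr_ae (Eventually.of_forall fun z => ?_)
    simp only [Set.indicator_apply]
    split_ifs <;> simp
  have e2 : ∫ z, (Set.Ioc (-δ) δ)ᶜ.indicator (fun z => z ^ 2 / (2 * σ ^ 2)) z ∂(gaussianReal 0 v) =
      Qf (δ / σ) + δ * gpdf σ δ := by
    have h1 : ∫ z, (Set.Ioc (-δ) δ).indicator (fun z => z ^ 2 / (2 * σ ^ 2)) z ∂(gaussianReal 0 v)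
        = (1 - 2 * Qf (δ / σ)) / 2 - δ * gpdf σ δ := by
      rw [integral_gauss hσ v hv, ← integral_z2 hσ, intervalIntegral.integral_of_le (by linarith),
        ← integral_indicator measurableSet_Ioc]
      refine integral_congr_ae (Eventually.of_forall fun z => ?_)
      simp only [Set.indicator_apply]
      split_ifs <;> simp
    have h2 : ∫ z, z ^ 2 / (2 * σ ^ 2) ∂(gaussianReal 0 v) = 1 / 2 := by
      rw [integral_div, gauss_sq_integral, hv]
      field_simp
    have h3 := integral_add_compl (μ := gaussianReal 0 v) (measurableSet_Ioc (a := -δ) (b := δ))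
      (hsq.div_const (2 * σ ^ 2))
    rw [← integral_indicator measurableSet_Ioc, ← integral_indicator measurableSet_Ioc.compl,
      h1, h2] at h3
    linarith
  have hT : ∫ z, Tb A δ m σ x z ∂(gaussianReal 0 v) =
      Real.log (Econst A δ m σ) + m / A * x
        + m / A * (σ ^ 2 * (gpdf σ (-δ - x) - gpdf σ (A + δ - x)))
        + (Qf (δ / σ) + δ * gpdf σ δ) := by
    unfold Tb
    have i0 : Integrable (fun _ : ℝ => Real.log (Econst A δ m σ) + m / A * x)
      (gaussianReal 0 v) := integrable_const _
    have i1 : Integrable (fun z : ℝ => m / A * (Set.Ioc (-δ - x) (A + δ - x)).indicator id z)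
      (gaussianReal 0 v) := hi1.const_mul _
    have i2 : Integrable (fun z : ℝ => Real.log (Econst A δ m σ) + m / A * x +
      m / A * (Set.Ioc (-δ - x) (A + δ - x)).indicator id z) (gaussianReal 0 v) := i0.add i1
    rw [integral_add i2 hi2, integral_add i0 i1, integral_const_mul, e1, e2]
    simp
  rw [hT]
  unfold Kb
  have h5 : gpdf σ (-δ - x) ≤ gpdf σ δ := by
    unfold gpdf
    gcongr ?_ * Real.exp (-?_ / _)
    nlinarith
  have h6 : gpdf σ (A + δ) ≤ gpdf σ (A + δ - x) := by
    unfold gpdf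
    gcongr ?_ * Real.exp (-?_ / _)
    nlinarith
  have h7 : m / A * (σ ^ 2 * (gpdf σ (-δ - x) - gpdf σ (A + δ - x))) ≤
      m / A * (σ ^ 2 * (gpdf σ δ - gpdf σ (A + δ))) := by
    gcongr
  have h8 : m / A * (σ ^ 2 * (gpdf σ δ - gpdf σ (A + δ))) =
      m / (A * Real.sqrt (2 * Real.pi)) * (σ * (Real.exp (-(δ ^ 2) / (2 * σ ^ 2))
      - Real.exp (-((A + δ) ^ 2) / (2 * σ ^ 2)))) := by
    unfold gpdf
    field_simp
  have h9 : δ * gpdf σ δ =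
      δ / (Real.sqrt (2 * Real.pi) * σ) * Real.exp (-(δ ^ 2) / (2 * σ ^ 2)) := by
    unfold gpdf
    field_simp
  linarith

end OneDim

end MimoOptical

namespace MimoOptical

section MultiGauss

instance stdGaussian_prob (n : ℕ) : IsProbabilityMeasure (stdGaussian n) := by
  unfold stdGaussian; infer_instance

theorem lintegral_ofReal_prod {n : ℕ} (m : Fin n → Measure ℝ) [∀ i, SigmaFinite (m i)]
    (f : Fin n → ℝ → ℝ) (hf : ∀ i, Integrable (f i) (m i)) (h0 : ∀ i x, 0 ≤ f i x) :
    ∫⁻ z, ENNReal.ofReal (∏ i, f i (z i)) ∂(Measure.pi m) =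
      ∏ i, ∫⁻ x, ENNReal.ofReal (f i x) ∂(m i) := by
  rw [← ofReal_integral_eq_lintegral_ofReal (Integrable.fintype_prod_dep hf)
    (ae_of_all _ fun z => Finset.prod_nonneg fun i _ => h0 i _), integral_fintype_prod_eq_prod,
    ENNReal.ofReal_prod_of_nonneg (fun i _ => integral_nonneg (h0 i))]
  exact Finset.prod_congr rfl fun i _ =>
    ofReal_integral_eq_lintegral_ofReal (hf i) (ae_of_all _ (h0 i))

/-- Density of the standard Gaussian vector. -/
def npdf (n : ℕ) (z : Fin n → ℝ) : ℝ := ∏ i, gpdf 1 (z i)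

theorem npdf_pos {n : ℕ} (z : Fin n → ℝ) : 0 < npdf n z :=
  Finset.prod_pos fun _ _ => gpdf_pos one_pos _

theorem npdf_measurable (n : ℕ) : Measurable (npdf n) := by
  unfold npdf
  refine Finset.measurable_prod _ fun i _ => ?_
  have : Measurable (gpdf 1) := by unfold gpdf; fun_prop
  exact this.comp (measurable_pi_apply i)

theorem gpdf_one_le (x : ℝ) : gpdf 1 x ≤ 1 := by
  unfold gpdf
  have h1 : Real.exp (-(x ^ 2) / (2 * 1 ^ 2)) ≤ 1 := by
    rw [Real.exp_le_one_iff]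
    nlinarith [sq_nonneg x]
  have h2 : (1 : ℝ) ≤ Real.sqrt (2 * Real.pi) := by
    rw [Real.one_le_sqrt]
    nlinarith [Real.pi_gt_three]
  have h3 : (Real.sqrt (2 * Real.pi) * 1)⁻¹ ≤ 1 := inv_le_one_of_one_le₀ (by simpa using h2)
  exact mul_le_one₀ h3 (Real.exp_pos _).le h1

theorem npdf_le_one {n : ℕ} (z : Fin n → ℝ) : npdf n z ≤ 1 :=
  Finset.prod_le_one (fun _ _ => (gpdf_pos one_pos _).le) fun _ _ => gpdf_one_le _

theorem stdGaussian_eq (n : ℕ) :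
    stdGaussian n = (volume : Measure (Fin n → ℝ)).withDensity
      (fun z => ENNReal.ofReal (npdf n z)) := by
  unfold stdGaussian
  refine Measure.pi_eq fun s hs => ?_
  rw [withDensity_apply _ (MeasurableSet.univ_pi hs), volume_pi, Measure.restrict_pi_pi]
  unfold npdf
  rw [lintegral_ofReal_prod]
  · refine Finset.prod_congr rfl fun i _ => ?_
    rw [gaussianReal_of_var_ne_zero _ one_ne_zero, withDensity_apply _ (hs i)]
    refine lintegral_congr fun x => ?_
    rw [gaussianPDF, gpdf_eq one_pos 1 (by simp)]
  · intro i
    exact (gpdf_integrable one_pos).integrableOn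
  · intro i x
    exact (gpdf_pos one_pos x).le

theorem npdf_lintegral (n : ℕ) : ∫⁻ z, ENNReal.ofReal (npdf n z) = 1 := by
  have := measure_univ (μ := stdGaussian n)
  rw [stdGaussian_eq, withDensity_apply _ MeasurableSet.univ, Measure.restrict_univ] at this
  exact this

theorem stdGaussian_map_linear {n : ℕ} (c : Fin n → ℝ) (v : ℝ≥0) (hv : (v : ℝ) = ∑ i, c i ^ 2) :
    (stdGaussian n).map (fun z => ∑ i, c i * z i) = gaussianReal 0 v := by
  have hm : Measurable (fun z : Fin n → ℝ => ∑ i, c i * z i) := by fun_prop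
  have : IsProbabilityMeasure ((stdGaussian n).map (fun z => ∑ i, c i * z i)) :=
    Measure.isProbabilityMeasure_map hm.aemeasurable
  refine Measure.ext_of_charFun ?_
  ext t
  rw [charFun_gaussianReal, charFun_apply_real, integral_map hm.aemeasurable (by fun_prop)]
  have h1 : ∀ z : Fin n → ℝ, Complex.exp (t * ((∑ i, c i * z i : ℝ) : ℂ) * Complex.I) =
      ∏ i, Complex.exp ((t * c i : ℝ) * (z i : ℂ) * Complex.I) := by
    intro z
    rw [← Complex.exp_sum]
    congr 1
    push_cast
    rw [Finset.mul_sum, Finset.sum_mul]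
    exact Finset.sum_congr rfl fun i _ => by ring
  simp_rw [h1]
  unfold stdGaussian
  rw [integral_fintype_prod_eq_prod (fun i (x : ℝ) =>
    Complex.exp ((t * c i : ℝ) * (x : ℂ) * Complex.I))]
  have h2 : ∀ i, ∫ x : ℝ, Complex.exp ((t * c i : ℝ) * (x : ℂ) * Complex.I) ∂(gaussianReal 0 1) =
      Complex.exp (- (t * c i) ^ 2 / 2) := by
    intro i
    rw [← charFun_apply_real, charFun_gaussianReal]
    congr 1
    push_cast
    ring
  simp_rw [h2]
  rw [← Complex.exp_sum]
  congr 1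
  have hv' : ((v : ℝ) : ℂ) = ∑ i, (c i : ℂ) ^ 2 := by rw [hv]; push_cast; rfl
  have : ((v : ℝ≥0) : ℂ) = ((v : ℝ) : ℂ) := rfl
  simp only [hv', Complex.ofReal_zero, mul_zero, zero_mul, zero_sub]
  rw [Finset.sum_mul, Finset.sum_div, ← Finset.sum_neg_distrib]
  exact Finset.sum_congr rfl fun i _ => by ring

theorem stdGaussian_map_eval {n : ℕ} (i : Fin n) :
    (stdGaussian n).map (fun z => z i) = gaussianReal 0 1 := by
  have := (measurePreserving_eval (fun _ : Fin n => gaussianReal 0 1) i).map_eq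
  exact this

theorem log_npdf (n : ℕ) (z : Fin n → ℝ) :
    Real.log (npdf n z) = ∑ i, Real.log (gpdf 1 (z i)) := by
  unfold npdf
  exact Real.log_prod fun i _ => (gpdf_pos one_pos _).ne'

theorem log_gpdf_one (x : ℝ) :
    Real.log (gpdf 1 x) = -(Real.log (2 * Real.pi) / 2) - x ^ 2 / 2 := by
  unfold gpdf
  have h : (0:ℝ) < Real.sqrt (2 * Real.pi) := by positivity
  rw [mul_one, Real.log_mul (by positivity) (Real.exp_pos _).ne', Real.log_inv, Real.log_exp,
    Real.log_sqrt (by positivity)]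
  ring

theorem sq_eval_integrable {n : ℕ} (i : Fin n) :
    Integrable (fun z : Fin n → ℝ => (z i) ^ 2) (stdGaussian n) := by
  have h := gauss_sq_integrable 1
  rw [← stdGaussian_map_eval i] at h
  exact (integrable_map_measure (g := fun x : ℝ => x ^ 2) (by fun_prop)
    (measurable_pi_apply i).aemeasurable).1 h

theorem log_npdf_integrable (n : ℕ) :
    Integrable (fun z => Real.log (npdf n z)) (stdGaussian n) := by
  simp_rw [log_npdf, log_gpdf_one]
  exact integrable_finsetSum _ fun i _ =>
    (integrable_const _).sub ((sq_eval_integrable i).div_const 2)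

theorem log_npdf_integral (n : ℕ) :
    ∫ z, Real.log (npdf n z) ∂(stdGaussian n) = -(n * Real.log (Real.sqrt (2 * Real.pi * Real.exp 1))) := by
  simp_rw [log_npdf, log_gpdf_one]
  rw [integral_finsetSum _ (fun i _ => (by
    exact (integrable_const _).sub ((sq_eval_integrable i).div_const 2) :
      Integrable (fun z : Fin n → ℝ => -(Real.log (2 * Real.pi) / 2) - (z i) ^ 2 / 2)
        (stdGaussian n)))]
  have : ∀ i : Fin n, ∫ z : Fin n → ℝ, (-(Real.log (2 * Real.pi) / 2) - (z i) ^ 2 / 2) ∂(stdGaussian n) =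
      -Real.log (Real.sqrt (2 * Real.pi * Real.exp 1)) := by
    intro i
    rw [integral_sub (integrable_const _) ((sq_eval_integrable i).div_const 2), integral_div]
    have h2 : ∫ z : Fin n → ℝ, (z i) ^ 2 ∂(stdGaussian n) = 1 := by
      have h := gauss_sq_integral 1
      rw [← stdGaussian_map_eval i, integral_map (measurable_pi_apply i).aemeasurable (by fun_prop)] at h
      simpa using h
    rw [h2, Real.log_sqrt (by positivity), Real.log_mul (by positivity) (Real.exp_pos _).ne',
      Real.log_exp]
    simp
    ring
  simp [this]

theorem jointLaw_eq {nt nr : ℕ} (H : Matrix (Fin nr) (Fin nt) ℝ) (μ : Measure (Fin nt → ℝ))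
    [IsProbabilityMeasure μ] :
    jointLaw H μ = (μ.prod (volume : Measure (Fin nr → ℝ))).withDensity
      (fun p => ENNReal.ofReal (npdf nr (p.2 - H *ᵥ p.1))) := by
  have hcont : Continuous fun x : Fin nt → ℝ => H *ᵥ x := by fun_prop
  have hHm : Measurable fun x : Fin nt → ℝ => H *ᵥ x := hcont.measurable
  have hf : Measurable fun p : (Fin nt → ℝ) × (Fin nr → ℝ) => (p.1, H *ᵥ p.1 + p.2) := by fun_prop
  have hn := npdf_measurable nr
  have hk : Measurable fun p : (Fin nt → ℝ) × (Fin nr → ℝ) =>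
      ENNReal.ofReal (npdf nr (p.2 - H *ᵥ p.1)) := by
    refine ENNReal.measurable_ofReal.comp (hn.comp ?_)
    fun_prop
  refine Measure.ext_of_lintegral _ fun g hg => ?_
  unfold jointLaw
  rw [lintegral_map hg hf, lintegral_prod (fun p => g (p.1, H *ᵥ p.1 + p.2)) (hg.comp hf).aemeasurable,
    lintegral_withDensity_eq_lintegral_mul _ hk hg, lintegral_prod _ (hk.mul hg).aemeasurable]
  refine lintegral_congr fun x => ?_
  have hgx : Measurable fun z => g (x, H *ᵥ x + z) := by fun_prop
  rw [stdGaussian_eq, lintegral_withDensity_eq_lintegral_mul _ (by fun_prop) hgx]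
  rw [← lintegral_add_left_eq_self (fun y => ((fun p : (Fin nt → ℝ) × (Fin nr → ℝ) =>
    ENNReal.ofReal (npdf nr (p.2 - H *ᵥ p.1))) * g) (x, y)) (H *ᵥ x)]
  simp

theorem npdf_shift_lintegral {n : ℕ} (a : Fin n → ℝ) :
    ∫⁻ y, ENNReal.ofReal (npdf n (y - a)) = 1 := by
  rw [lintegral_sub_right_eq_self (fun y => ENNReal.ofReal (npdf n y)) a]
  exact npdf_lintegral n

section SigmaU
variable {nt nr : ℕ}

theorem sigma_arg (H : Matrix (Fin nr) (Fin nt) ℝ) (U : Finset (Fin nt)) (l : Fin nr) :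
    (((HU H U)⁻¹) * ((HU H U)⁻¹)ᵀ) l l = ∑ i, ((HU H U)⁻¹ l i) ^ 2 := by
  rw [Matrix.mul_apply]
  exact Finset.sum_congr rfl fun i _ => by rw [Matrix.transpose_apply, sq]

theorem sigma_sq (H : Matrix (Fin nr) (Fin nt) ℝ) (U : Finset (Fin nt)) (l : Fin nr) :
    sigmaUl H U l ^ 2 = ∑ i, ((HU H U)⁻¹ l i) ^ 2 := by
  unfold sigmaUl
  rw [sigma_arg, Real.sq_sqrt (Finset.sum_nonneg fun i _ => sq_nonneg _)]

theorem sigma_pos (H : Matrix (Fin nr) (Fin nt) ℝ) {U : Finset (Fin nt)} (hU : U ∈ goodSets H)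
    (l : Fin nr) : 0 < sigmaUl H U l := by
  unfold sigmaUl
  rw [Real.sqrt_pos, sigma_arg]
  refine (Finset.sum_nonneg fun i _ => sq_nonneg _).lt_of_ne fun h => ?_
  have h0 : ∀ i, (HU H U)⁻¹ l i = 0 := by
    intro i
    have := (Finset.sum_eq_zero_iff_of_nonneg (fun i _ => sq_nonneg ((HU H U)⁻¹ l i))).1 h.symm i
      (Finset.mem_univ i)
    simpa using this
  have h1 : ((HU H U)⁻¹ * HU H U) l l = 1 := by
    rw [Matrix.nonsing_inv_mul _ (HU_det_isUnit H hU), Matrix.one_apply_eq]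
  rw [Matrix.mul_apply] at h1
  simp [h0] at h1

theorem map_inv_row (H : Matrix (Fin nr) (Fin nt) ℝ) (U : Finset (Fin nt)) (l : Fin nr)
    (v : ℝ≥0) (hv : (v : ℝ) = sigmaUl H U l ^ 2) :
    (stdGaussian nr).map (fun z => ((HU H U)⁻¹ *ᵥ z) l) = gaussianReal 0 v := by
  rw [sigma_sq] at hv
  exact stdGaussian_map_linear (fun i => (HU H U)⁻¹ l i) v hv

/-- Auxiliary output density attached to the cell of `U`. -/
def rU (H : Matrix (Fin nr) (Fin nt) ℝ) (A δ m : ℝ) (U : Finset (Fin nt)) (y : Fin nr → ℝ) : ℝ :=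
  |(HU H U).det|⁻¹ * ∏ l, fd A δ m (sigmaUl H U l) (((HU H U)⁻¹ *ᵥ (y - vU H A U)) l)

variable {A δ m : ℝ}

theorem rU_pos (H : Matrix (Fin nr) (Fin nt) ℝ) {U : Finset (Fin nt)} (hU : U ∈ goodSets H)
    (hA : 0 < A) (hδ : 0 < δ) (hm : 0 < m) (y : Fin nr → ℝ) : 0 < rU H A δ m U y := by
  have h1 : 0 < |(HU H U).det| := abs_pos.2 (HU_det_isUnit H hU).ne_zero
  exact mul_pos (inv_pos.2 h1) (Finset.prod_pos fun l _ => fd_pos hA hδ hm (sigma_pos H hU l) _)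

theorem rU_measurable (H : Matrix (Fin nr) (Fin nt) ℝ) (A δ m : ℝ) (U : Finset (Fin nt)) :
    Measurable (rU H A δ m U) := by
  unfold rU
  refine Measurable.const_mul ?_ _
  refine Finset.measurable_prod _ fun l _ => (fd_measurable A δ m _).comp ?_
  have : Continuous fun y : Fin nr → ℝ => ((HU H U)⁻¹ *ᵥ (y - vU H A U)) l := by fun_prop
  exact this.measurable

theorem rU_lintegral (H : Matrix (Fin nr) (Fin nt) ℝ) {U : Finset (Fin nt)} (hU : U ∈ goodSets H)
    (hA : 0 < A) (hδ : 0 < δ) (hm : 0 < m) :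
    ∫⁻ y, ENNReal.ofReal (rU H A δ m U y) ≤ 1 := by
  have hdet := (HU_det_isUnit H hU).ne_zero
  have h1 : 0 < |(HU H U).det| := abs_pos.2 hdet
  set F : (Fin nr → ℝ) → ℝ≥0∞ := fun w => ENNReal.ofReal (∏ l, fd A δ m (sigmaUl H U l) (w l))
    with hF
  have hFm : Measurable F := by
    refine ENNReal.measurable_ofReal.comp (Finset.measurable_prod _ fun l _ => ?_)
    exact (fd_measurable A δ m _).comp (measurable_pi_apply l)
  have hFi : ∫⁻ w, F w ≤ 1 := by
    rw [hF, volume_pi, lintegral_ofReal_prod]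
    · exact Finset.prod_le_one' fun l _ => fd_lintegral hA hδ hm (sigma_pos H hU l)
    · intro l
      refine ⟨(fd_measurable A δ m _).aestronglyMeasurable, ?_⟩
      rw [hasFiniteIntegral_iff_ofReal
        (ae_of_all _ fun x => (fd_pos hA hδ hm (sigma_pos H hU l) x).le)]
      exact (fd_lintegral hA hδ hm (sigma_pos H hU l)).trans_lt ENNReal.one_lt_top
    · intro l x
      exact (fd_pos hA hδ hm (sigma_pos H hU l) x).le
  have hr : ∀ y, ENNReal.ofReal (rU H A δ m U y) =
      ENNReal.ofReal (|(HU H U).det|⁻¹) * F ((HU H U)⁻¹ *ᵥ (y - vU H A U)) := by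
    intro y
    rw [rU, ENNReal.ofReal_mul (inv_pos.2 h1).le]
  have hcm : Measurable fun y : Fin nr → ℝ => (HU H U)⁻¹ *ᵥ y := by
    have : Continuous fun y : Fin nr → ℝ => (HU H U)⁻¹ *ᵥ y := by fun_prop
    exact this.measurable
  simp_rw [hr]
  rw [lintegral_const_mul' _ _ ENNReal.ofReal_ne_top,
    lintegral_sub_right_eq_self (fun y => F ((HU H U)⁻¹ *ᵥ y)) (vU H A U)]
  have hdi : ((HU H U)⁻¹).det ≠ 0 := by
    rw [Matrix.det_nonsing_inv, Ring.inverse_eq_inv']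
    exact inv_ne_zero hdet
  have hmap := Real.map_matrix_volume_pi_eq_smul_volume_pi hdi
  have h2 : ∫⁻ y, F ((HU H U)⁻¹ *ᵥ y) = ENNReal.ofReal |(HU H U).det| * ∫⁻ w, F w := by
    rw [← lintegral_map hFm hcm]
    have : (volume : Measure (Fin nr → ℝ)).map (fun y => (HU H U)⁻¹ *ᵥ y) =
        ENNReal.ofReal |(HU H U).det| • volume := by
      have h3 : |(((HU H U)⁻¹).det)⁻¹| = |(HU H U).det| := by
        rw [Matrix.det_nonsing_inv, Ring.inverse_eq_inv', inv_inv]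
      rw [← h3, ← hmap]
      rfl
    rw [this, lintegral_smul_measure, smul_eq_mul]
  rw [h2, ← mul_assoc, ← ENNReal.ofReal_mul (inv_pos.2 h1).le, inv_mul_cancel₀ h1.ne',
    ENNReal.ofReal_one, one_mul]
  exact hFi

theorem lam_shift (H : Matrix (Fin nr) (Fin nt) ℝ) (A : ℝ) (U : Finset (Fin nt))
    (x : Fin nt → ℝ) (y : Fin nr → ℝ) (l : Fin nr) :
    ((HU H U)⁻¹ *ᵥ (y - vU H A U)) l = lamU H A U x l + ((HU H U)⁻¹ *ᵥ (y - H *ᵥ x)) l := by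
  unfold lamU
  rw [← Pi.add_apply, ← Matrix.mulVec_add]
  congr 2
  abel

theorem neg_log_rU_le (H : Matrix (Fin nr) (Fin nt) ℝ) {U : Finset (Fin nt)} (hU : U ∈ goodSets H)
    (hA : 0 < A) (hδ : 0 < δ) (hm : 0 < m) (x : Fin nt → ℝ) (y : Fin nr → ℝ)
    (hx : ∀ l, lamU H A U x l ∈ Set.Icc (0 : ℝ) A) :
    -Real.log (rU H A δ m U y) ≤ Real.log |(HU H U).det| +
      ∑ l, Tb A δ m (sigmaUl H U l) (lamU H A U x l) (((HU H U)⁻¹ *ᵥ (y - H *ᵥ x)) l) := by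
  have h1 : 0 < |(HU H U).det| := abs_pos.2 (HU_det_isUnit H hU).ne_zero
  unfold rU
  rw [Real.log_mul (inv_pos.2 h1).ne'
    (Finset.prod_pos fun l _ => fd_pos hA hδ hm (sigma_pos H hU l) _).ne', Real.log_inv,
    Real.log_prod (fun l _ => (fd_pos hA hδ hm (sigma_pos H hU l) _).ne'), neg_add, neg_neg,
    ← Finset.sum_neg_distrib]
  gcongr with l _
  rw [lam_shift H A U x y l]
  exact neg_log_fd_le hA hδ hm (sigma_pos H hU l) (hx l) _

end SigmaU

end MultiGauss

end MimoOptical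

namespace MimoOptical

section Weights

variable {nt nr : ℕ}

/-- The finset of good column sets. -/
def GS (H : Matrix (Fin nr) (Fin nt) ℝ) : Finset (Finset (Fin nt)) :=
  (Set.toFinite (goodSets H)).toFinset

theorem mem_GS (H : Matrix (Fin nr) (Fin nt) ℝ) {U : Finset (Fin nt)} :
    U ∈ GS H ↔ U ∈ goodSets H := by
  unfold GS; simp

theorem finsum_GS (H : Matrix (Fin nr) (Fin nt) ℝ) (f : Finset (Fin nt) → ℝ) :
    ∑ᶠ U ∈ goodSets H, f U = ∑ U ∈ GS H, f U :=
  finsum_mem_eq_finite_toFinset_sum f (Set.toFinite (goodSets H))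

/-- Inputs whose image lies in the cell of `U`. -/
def EU (H : Matrix (Fin nr) (Fin nt) ℝ) (A : ℝ) (U : Finset (Fin nt)) : Set (Fin nt → ℝ) :=
  {x | ∀ l, lamU H A U x l ∈ Set.Icc (0 : ℝ) A}

theorem lamU_measurable (H : Matrix (Fin nr) (Fin nt) ℝ) (A : ℝ) (U : Finset (Fin nt))
    (l : Fin nr) : Measurable fun x => lamU H A U x l := by
  have : Continuous fun x => lamU H A U x l := by unfold lamU; fun_prop
  exact this.measurable

theorem EU_measurable (H : Matrix (Fin nr) (Fin nt) ℝ) (A : ℝ) (U : Finset (Fin nt)) :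
    MeasurableSet (EU H A U) := by
  unfold EU
  rw [Set.ofPred_forall]
  exact MeasurableSet.iInter fun l => lamU_measurable H A U l measurableSet_Icc

/-- Total number of cells containing `x`. -/
def wden (H : Matrix (Fin nr) (Fin nt) ℝ) (A : ℝ) (x : Fin nt → ℝ) : ℝ :=
  ∑ U ∈ GS H, (EU H A U).indicator (fun _ => (1 : ℝ)) x

/-- Weights of the cells. -/
def wU (H : Matrix (Fin nr) (Fin nt) ℝ) (A : ℝ) (U : Finset (Fin nt)) (x : Fin nt → ℝ) : ℝ :=
  (EU H A U).indicator (fun _ => (1 : ℝ)) x / wden H A x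

theorem ind_nonneg (s : Set (Fin nt → ℝ)) (x : Fin nt → ℝ) :
    0 ≤ s.indicator (fun _ => (1 : ℝ)) x :=
  Set.indicator_nonneg (fun _ _ => zero_le_one) x

theorem wden_nonneg (H : Matrix (Fin nr) (Fin nt) ℝ) (A : ℝ) (x : Fin nt → ℝ) :
    0 ≤ wden H A x := Finset.sum_nonneg fun U _ => ind_nonneg _ x

theorem wU_nonneg (H : Matrix (Fin nr) (Fin nt) ℝ) (A : ℝ) (U : Finset (Fin nt))
    (x : Fin nt → ℝ) : 0 ≤ wU H A U x :=
  div_nonneg (ind_nonneg _ x) (wden_nonneg H A x)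

theorem wU_le_one (H : Matrix (Fin nr) (Fin nt) ℝ) (A : ℝ) {U : Finset (Fin nt)}
    (hU : U ∈ GS H) (x : Fin nt → ℝ) : wU H A U x ≤ 1 :=
  div_le_one_of_le₀ (Finset.single_le_sum (f := fun U => (EU H A U).indicator (fun _ => (1 : ℝ)) x)
    (fun U _ => ind_nonneg _ x) hU) (wden_nonneg H A x)

theorem wU_mem (H : Matrix (Fin nr) (Fin nt) ℝ) (A : ℝ) {U : Finset (Fin nt)}
    {x : Fin nt → ℝ} (h : wU H A U x ≠ 0) : ∀ l, lamU H A U x l ∈ Set.Icc (0 : ℝ) A := by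
  by_contra hx
  have : x ∉ EU H A U := hx
  exact h (by unfold wU; rw [Set.indicator_of_notMem this, zero_div])

theorem wden_measurable (H : Matrix (Fin nr) (Fin nt) ℝ) (A : ℝ) : Measurable (wden H A) :=
  Finset.measurable_fun_sum _ fun U _ => measurable_const.indicator (EU_measurable H A U)

theorem wU_measurable (H : Matrix (Fin nr) (Fin nt) ℝ) (A : ℝ) (U : Finset (Fin nt)) :
    Measurable (wU H A U) :=
  (measurable_const.indicator (EU_measurable H A U)).div (wden_measurable H A)

theorem wU_sum (H : Matrix (Fin nr) (Fin nt) ℝ) (hrank : H.rank = nr) {A : ℝ} (hA : 0 < A)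
    (htie : ∀ U ∈ goodSets H, ∀ j ∉ U, aUj H U j ≠ 1)
    (x : Fin nt → ℝ) (hx : ∀ k, x k ∈ Set.Icc (0 : ℝ) A) : ∑ U ∈ GS H, wU H A U x = 1 := by
  unfold wU
  rw [← Finset.sum_div]
  refine div_self ?_
  obtain ⟨U, hU, h⟩ := cover H hrank hA htie x hx
  have h1 : (1 : ℝ) ≤ wden H A x := by
    have := Finset.single_le_sum (f := fun U => (EU H A U).indicator (fun _ => (1 : ℝ)) x)
      (fun U _ => ind_nonneg _ x) ((mem_GS H).2 hU)
    have h2 : x ∈ EU H A U := h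
    simp only [Set.indicator_of_mem h2] at this
    exact this
  exact (zero_lt_one.trans_le h1).ne'

variable (μ : Measure (Fin nt → ℝ)) [IsProbabilityMeasure μ]

theorem wU_integrable (H : Matrix (Fin nr) (Fin nt) ℝ) (A : ℝ) {U : Finset (Fin nt)}
    (hU : U ∈ GS H) : Integrable (wU H A U) μ := by
  refine Integrable.of_bound (wU_measurable H A U).aestronglyMeasurable 1 (ae_of_all _ fun x => ?_)
  rw [Real.norm_eq_abs, abs_of_nonneg (wU_nonneg H A U x)]
  exact wU_le_one H A hU x

theorem wU_lam_bound (H : Matrix (Fin nr) (Fin nt) ℝ) {A : ℝ} (hA : 0 < A) {U : Finset (Fin nt)}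
    (hU : U ∈ GS H) (l : Fin nr) (x : Fin nt → ℝ) :
    0 ≤ wU H A U x * lamU H A U x l ∧ wU H A U x * lamU H A U x l ≤ A := by
  by_cases h : wU H A U x = 0
  · rw [h, zero_mul]; exact ⟨le_rfl, hA.le⟩
  · obtain ⟨h0, h1⟩ := wU_mem H A h l
    have h2 := wU_nonneg H A U x
    have h3 := wU_le_one H A hU x
    exact ⟨mul_nonneg h2 h0, by nlinarith⟩

theorem wU_lam_integrable (H : Matrix (Fin nr) (Fin nt) ℝ) {A : ℝ} (hA : 0 < A)
    {U : Finset (Fin nt)} (hU : U ∈ GS H) (l : Fin nr) :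
    Integrable (fun x => wU H A U x * lamU H A U x l) μ := by
  refine Integrable.of_bound
    ((wU_measurable H A U).mul (lamU_measurable H A U l)).aestronglyMeasurable A
    (ae_of_all _ fun x => ?_)
  have := wU_lam_bound H hA hU l x
  rw [Real.norm_eq_abs, abs_of_nonneg this.1]
  exact this.2

/-- The probability vector generated by the input law. -/
def pU (H : Matrix (Fin nr) (Fin nt) ℝ) (A : ℝ) (U : Finset (Fin nt)) : ℝ :=
  open Classical in if U ∈ goodSets H then ∫ x, wU H A U x ∂μ else 0

theorem pU_eq (H : Matrix (Fin nr) (Fin nt) ℝ) (A : ℝ) {U : Finset (Fin nt)} (hU : U ∈ GS H) :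
    pU μ H A U = ∫ x, wU H A U x ∂μ := by
  unfold pU
  rw [if_pos ((mem_GS H).1 hU)]

theorem pU_nonneg (H : Matrix (Fin nr) (Fin nt) ℝ) (A : ℝ) (U : Finset (Fin nt)) :
    0 ≤ pU μ H A U := by
  unfold pU
  split_ifs
  · exact integral_nonneg (wU_nonneg H A U)
  · exact le_rfl

theorem pU_sum (H : Matrix (Fin nr) (Fin nt) ℝ) (hrank : H.rank = nr) {A : ℝ} (hA : 0 < A)
    (htie : ∀ U ∈ goodSets H, ∀ j ∉ U, aUj H U j ≠ 1)
    (hμ : ∀ᵐ x ∂μ, ∀ k, x k ∈ Set.Icc (0 : ℝ) A) : ∑ U ∈ GS H, pU μ H A U = 1 := by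
  rw [Finset.sum_congr rfl fun U hU => pU_eq μ H A hU,
    ← integral_finsetSum _ fun U hU => wU_integrable μ H A hU]
  have : (fun x => ∑ U ∈ GS H, wU H A U x) =ᵐ[μ] fun _ => 1 := by
    filter_upwards [hμ] with x hx using wU_sum H hrank hA htie x hx
  rw [integral_congr_ae this]
  simp

theorem pU_probVec (H : Matrix (Fin nr) (Fin nt) ℝ) (hrank : H.rank = nr) {A : ℝ} (hA : 0 < A)
    (htie : ∀ U ∈ goodSets H, ∀ j ∉ U, aUj H U j ≠ 1)
    (hμ : ∀ᵐ x ∂μ, ∀ k, x k ∈ Set.Icc (0 : ℝ) A) : ProbVec H (pU μ H A) := by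
  refine ⟨pU_nonneg μ H A, fun U hU => ?_, ?_⟩
  · unfold pU; rw [if_neg hU]
  · rw [finsum_GS]; exact pU_sum μ H hrank hA htie hμ

theorem power_avg (H : Matrix (Fin nr) (Fin nt) ℝ) (hrank : H.rank = nr) {A α : ℝ} (hA : 0 < A)
    (htie : ∀ U ∈ goodSets H, ∀ j ∉ U, aUj H U j ≠ 1)
    (hμ : ∀ᵐ x ∂μ, ∀ k, x k ∈ Set.Icc (0 : ℝ) A)
    (hpow : (∫ x, ∑ k, |x k| ∂μ) ≤ α * A) :
    ∑ U ∈ GS H, ∑ l, ∫ x, wU H A U x * lamU H A U x l ∂μ +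
      A * ∑ U ∈ GS H, pU μ H A U * sU H U ≤ α * A := by
  refine le_trans (le_of_eq ?_) (le_trans
    (integral_mono_ae (f := fun x => ∑ U ∈ GS H, (∑ l, wU H A U x * lamU H A U x l
      + A * sU H U * wU H A U x)) (g := fun x => ∑ k, |x k|) ?_ ?_ ?_) hpow)
  · have hi : ∀ U ∈ GS H, Integrable (fun x => ∑ l, wU H A U x * lamU H A U x l
        + A * sU H U * wU H A U x) μ := fun U hU => (integrable_finsetSum _ fun l _ =>
      wU_lam_integrable μ H hA hU l).add ((wU_integrable μ H A hU).const_mul _)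
    rw [integral_finsetSum _ hi, Finset.mul_sum,
      ← Finset.sum_add_distrib]
    refine Finset.sum_congr rfl fun U hU => ?_
    rw [integral_add (integrable_finsetSum _ fun l _ =>
      wU_lam_integrable μ H hA hU l) ((wU_integrable μ H A hU).const_mul _),
      integral_finsetSum _ fun l _ => wU_lam_integrable μ H hA hU l, integral_const_mul,
      pU_eq μ H A hU]
    ring
  · exact integrable_finsetSum _ fun U hU => (integrable_finsetSum _ fun l _ =>
      wU_lam_integrable μ H hA hU l).add ((wU_integrable μ H A hU).const_mul _)
  · refine integrable_finsetSum _ fun k _ => ?_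
    refine Integrable.of_bound (measurable_pi_apply k).abs.aestronglyMeasurable A ?_
    filter_upwards [hμ] with x hx
    rw [Real.norm_eq_abs, abs_abs, abs_of_nonneg (hx k).1]
    exact (hx k).2
  · filter_upwards [hμ] with x hx
    have h1 : ∑ k, |x k| = ∑ k, x k := Finset.sum_congr rfl fun k _ => abs_of_nonneg (hx k).1
    simp only [h1]
    calc _ = ∑ U ∈ GS H, wU H A U x * (∑ l, lamU H A U x l + A * sU H U) := by
          refine Finset.sum_congr rfl fun U _ => ?_
          rw [mul_add, Finset.mul_sum]
          ring
      _ ≤ ∑ U ∈ GS H, wU H A U x * ∑ k, x k := by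
          gcongr with U hU
          · exact wU_nonneg H A U x
          · exact power_ineq H ((mem_GS H).1 hU) x hx
      _ = ∑ k, x k := by
          rw [← Finset.sum_mul, wU_sum H hrank hA htie x hx, one_mul]

theorem lam_avg_nonneg (H : Matrix (Fin nr) (Fin nt) ℝ) {A : ℝ} (hA : 0 < A) :
    0 ≤ ∑ U ∈ GS H, ∑ l, ∫ x, wU H A U x * lamU H A U x l ∂μ :=
  Finset.sum_nonneg fun U hU => Finset.sum_nonneg fun l _ =>
    integral_nonneg fun x => (wU_lam_bound H hA hU l x).1

end Weights

end MimoOptical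

namespace MimoOptical

section MainBound

variable {nt nr : ℕ}

theorem row_measurable (H : Matrix (Fin nr) (Fin nt) ℝ) (U : Finset (Fin nt)) (l : Fin nr) :
    Measurable fun z : Fin nr → ℝ => ((HU H U)⁻¹ *ᵥ z) l := by
  have : Continuous fun z : Fin nr → ℝ => ((HU H U)⁻¹ *ᵥ z) l := by fun_prop
  exact this.measurable

theorem row_sq_integrable (H : Matrix (Fin nr) (Fin nt) ℝ) (U : Finset (Fin nt)) (l : Fin nr) :
    Integrable (fun z : Fin nr → ℝ => (((HU H U)⁻¹ *ᵥ z) l) ^ 2) (stdGaussian nr) := by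
  have h := gauss_sq_integrable ⟨sigmaUl H U l ^ 2, sq_nonneg _⟩
  rw [← map_inv_row H U l ⟨sigmaUl H U l ^ 2, sq_nonneg _⟩ rfl] at h
  exact (integrable_map_measure (g := fun x : ℝ => x ^ 2) (by fun_prop)
    (row_measurable H U l).aemeasurable).1 h

/-- One term of the dual bound. -/
def tm (H : Matrix (Fin nr) (Fin nt) ℝ) (A δ m : ℝ) (U : Finset (Fin nt)) (l : Fin nr)
    (p : (Fin nt → ℝ) × (Fin nr → ℝ)) : ℝ :=
  wU H A U p.1 * Tb A δ m (sigmaUl H U l) (lamU H A U p.1 l) (((HU H U)⁻¹ *ᵥ p.2) l)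

theorem tm_measurable (H : Matrix (Fin nr) (Fin nt) ℝ) (A δ m : ℝ) (U : Finset (Fin nt))
    (l : Fin nr) : Measurable (tm H A δ m U l) := by
  unfold tm
  refine ((wU_measurable H A U).comp measurable_fst).mul ?_
  exact (Tb_measurable A δ m (sigmaUl H U l)).comp
    (((lamU_measurable H A U l).comp measurable_fst).prodMk
      ((row_measurable H U l).comp measurable_snd))

variable (μ : Measure (Fin nt → ℝ)) [IsProbabilityMeasure μ] {A δ m : ℝ}

theorem tm_integrable (H : Matrix (Fin nr) (Fin nt) ℝ) (hA : 0 < A) (hm : 0 < m)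
    {U : Finset (Fin nt)} (hU : U ∈ GS H) (l : Fin nr) :
    Integrable (tm H A δ m U l) (μ.prod (stdGaussian nr)) := by
  have hb : Integrable (fun z : Fin nr → ℝ => |Real.log (Econst A δ m (sigmaUl H U l))| + m +
      m / A * (1 + (((HU H U)⁻¹ *ᵥ z) l) ^ 2)
        + (((HU H U)⁻¹ *ᵥ z) l) ^ 2 / (2 * (sigmaUl H U l) ^ 2)) (stdGaussian nr) := by
    have := row_sq_integrable H U l
    exact ((integrable_const _).add (((integrable_const _).add this).const_mul _)).add
      (this.div_const _)
  refine (hb.comp_snd μ).mono' (tm_measurable H A δ m U l).aestronglyMeasurable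
    (ae_of_all _ fun p => ?_)
  have h0 := wU_nonneg H A U p.1
  have h1 := wU_le_one H A hU p.1
  rw [Real.norm_eq_abs, tm, abs_mul, abs_of_nonneg h0]
  have hnn : 0 ≤ |Real.log (Econst A δ m (sigmaUl H U l))| + m +
      m / A * (1 + (((HU H U)⁻¹ *ᵥ p.2) l) ^ 2)
        + (((HU H U)⁻¹ *ᵥ p.2) l) ^ 2 / (2 * (sigmaUl H U l) ^ 2) := by positivity
  by_cases h : wU H A U p.1 = 0
  · rw [h, zero_mul]; exact hnn
  · have h2 := Tb_abs_le (δ := δ) (σ := sigmaUl H U l) hA hm (wU_mem H A h l)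
      (((HU H U)⁻¹ *ᵥ p.2) l)
    exact (mul_le_of_le_one_left (abs_nonneg _) h1).trans h2

theorem tm_integral_le (H : Matrix (Fin nr) (Fin nt) ℝ) (hA : 0 < A) (hδ : 0 < δ) (hm : 0 < m)
    {U : Finset (Fin nt)} (hU : U ∈ GS H) (l : Fin nr) :
    ∫ p, tm H A δ m U l p ∂(μ.prod (stdGaussian nr)) ≤
      pU μ H A U * (Real.log (Econst A δ m (sigmaUl H U l)) + Kb A δ m (sigmaUl H U l))
        + m / A * ∫ x, wU H A U x * lamU H A U x l ∂μ := by
  have hi := tm_integrable (δ := δ) μ H hA hm hU l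
  have hi1 := (wU_integrable μ H A hU).mul_const
    (Real.log (Econst A δ m (sigmaUl H U l)) + Kb A δ m (sigmaUl H U l))
  have hi2 := (wU_lam_integrable μ H hA hU l).const_mul (m / A)
  rw [integral_prod _ hi, pU_eq μ H A hU, ← integral_mul_const, ← integral_const_mul,
    ← integral_add hi1 hi2]
  refine integral_mono hi.integral_prod_left (hi1.add hi2) fun x => ?_
  simp only [tm]
  rw [integral_const_mul]
  by_cases h : wU H A U x = 0
  · simp [h]
  · have hσ := sigma_pos H ((mem_GS H).1 hU) l
    have h2 := Tb_integral_le hA hδ hm hσ ⟨sigmaUl H U l ^ 2, sq_nonneg _⟩ rfl (wU_mem H A h l)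
    have hmeas : Measurable fun z => Tb A δ m (sigmaUl H U l) (lamU H A U x l) z :=
      (Tb_measurable A δ m (sigmaUl H U l)).comp measurable_prodMk_left
    rw [← map_inv_row H U l ⟨sigmaUl H U l ^ 2, sq_nonneg _⟩ rfl,
      integral_map (row_measurable H U l).aemeasurable hmeas.aestronglyMeasurable] at h2
    have h3 := mul_le_mul_of_nonneg_left h2 (wU_nonneg H A U x)
    refine h3.trans (le_of_eq ?_)
    ring

/-- Constant attached to the cell `U`. -/
def cU (H : Matrix (Fin nr) (Fin nt) ℝ) (A : ℝ) (U : Finset (Fin nt)) : ℝ :=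
  -Real.log (pU μ H A U) + Real.log |(HU H U).det|

/-- The dual bound as a function of input and noise. -/
def G0 (H : Matrix (Fin nr) (Fin nt) ℝ) (A δ m : ℝ) (p : (Fin nt → ℝ) × (Fin nr → ℝ)) : ℝ :=
  Real.log (npdf nr p.2) + ∑ U ∈ GS H, (wU H A U p.1 * cU μ H A U + ∑ l, tm H A δ m U l p)

theorem G0_measurable (H : Matrix (Fin nr) (Fin nt) ℝ) (A δ m : ℝ) :
    Measurable (G0 μ H A δ m) := by
  unfold G0
  refine ((npdf_measurable nr).log.comp measurable_snd).add ?_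
  refine Finset.measurable_fun_sum _ fun U _ => ?_
  refine (((wU_measurable H A U).comp measurable_fst).mul_const _).add ?_
  exact Finset.measurable_fun_sum _ fun l _ => tm_measurable H A δ m U l

theorem G0_integrable (H : Matrix (Fin nr) (Fin nt) ℝ) (hA : 0 < A) (hm : 0 < m) :
    Integrable (G0 μ H A δ m) (μ.prod (stdGaussian nr)) := by
  unfold G0
  refine ((log_npdf_integrable nr).comp_snd μ).add (integrable_finsetSum _ fun U hU => ?_)
  refine (((wU_integrable μ H A hU).mul_const _).comp_fst (stdGaussian nr)).add ?_
  exact integrable_finsetSum _ fun l _ => tm_integrable μ H hA hm hU l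

theorem G0_integral_le (H : Matrix (Fin nr) (Fin nt) ℝ) (hA : 0 < A) (hδ : 0 < δ) (hm : 0 < m) :
    ∫ p, G0 μ H A δ m p ∂(μ.prod (stdGaussian nr)) ≤
      -(nr * Real.log (Real.sqrt (2 * Real.pi * Real.exp 1)))
      + ∑ U ∈ GS H, pU μ H A U * (cU μ H A U + ∑ l,
          (Real.log (Econst A δ m (sigmaUl H U l)) + Kb A δ m (sigmaUl H U l)))
      + m / A * ∑ U ∈ GS H, ∑ l, ∫ x, wU H A U x * lamU H A U x l ∂μ := by
  have hi1 : Integrable (fun p : (Fin nt → ℝ) × (Fin nr → ℝ) => Real.log (npdf nr p.2))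
    (μ.prod (stdGaussian nr)) := (log_npdf_integrable nr).comp_snd μ
  have hi2 : ∀ U ∈ GS H, Integrable (fun p : (Fin nt → ℝ) × (Fin nr → ℝ) =>
      wU H A U p.1 * cU μ H A U) (μ.prod (stdGaussian nr)) := fun U hU =>
    ((wU_integrable μ H A hU).mul_const _).comp_fst (stdGaussian nr)
  have hi3 : ∀ U ∈ GS H, Integrable (fun p : (Fin nt → ℝ) × (Fin nr → ℝ) =>
      ∑ l, tm H A δ m U l p) (μ.prod (stdGaussian nr)) := fun U hU =>
    integrable_finsetSum _ fun l _ => tm_integrable μ H hA hm hU l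
  have hi4 : ∀ U ∈ GS H, Integrable (fun p : (Fin nt → ℝ) × (Fin nr → ℝ) =>
      wU H A U p.1 * cU μ H A U + ∑ l, tm H A δ m U l p) (μ.prod (stdGaussian nr)) :=
    fun U hU => (hi2 U hU).add (hi3 U hU)
  unfold G0
  rw [integral_add hi1 (integrable_finsetSum _ hi4), integral_finsetSum _ hi4,
    integral_fun_snd (fun z => Real.log (npdf nr z)), log_npdf_integral, add_assoc]
  simp only [probReal_univ, one_smul]
  rw [Finset.mul_sum, ← Finset.sum_add_distrib]
  gcongr with U hU
  rw [integral_add (hi2 U hU) (hi3 U hU), integral_finsetSum _ fun l _ =>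
    tm_integrable μ H hA hm hU l, integral_fun_fst (fun x => wU H A U x * cU μ H A U),
    integral_mul_const, ← pU_eq μ H A hU]
  simp only [probReal_univ, one_smul]
  rw [mul_add, add_assoc, Finset.mul_sum, Finset.mul_sum, ← Finset.sum_add_distrib]
  gcongr with l _
  exact tm_integral_le μ H hA hδ hm hU l

/-- Mixture of the auxiliary densities. -/
def rmix (H : Matrix (Fin nr) (Fin nt) ℝ) (A δ m : ℝ) (y : Fin nr → ℝ) : ℝ :=
  ∑ U ∈ GS H, pU μ H A U * rU H A δ m U y

theorem rmix_ge (H : Matrix (Fin nr) (Fin nt) ℝ) (hA : 0 < A) (hδ : 0 < δ) (hm : 0 < m)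
    {U : Finset (Fin nt)} (hU : U ∈ GS H) (y : Fin nr → ℝ) :
    pU μ H A U * rU H A δ m U y ≤ rmix μ H A δ m y :=
  Finset.single_le_sum (f := fun U => pU μ H A U * rU H A δ m U y)
    (fun V hV => mul_nonneg (pU_nonneg μ H A V)
      (rU_pos H ((mem_GS H).1 hV) hA hδ hm y).le) hU

theorem rmix_pos (H : Matrix (Fin nr) (Fin nt) ℝ) (hA : 0 < A) (hδ : 0 < δ) (hm : 0 < m)
    (hs : ∑ U ∈ GS H, pU μ H A U = 1) (y : Fin nr → ℝ) : 0 < rmix μ H A δ m y := by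
  obtain ⟨U, hU, hp⟩ : ∃ U ∈ GS H, pU μ H A U ≠ 0 := by
    by_contra hcon
    push Not at hcon
    rw [Finset.sum_eq_zero hcon] at hs
    exact zero_ne_one hs
  exact (mul_pos ((pU_nonneg μ H A U).lt_of_ne' hp)
    (rU_pos H ((mem_GS H).1 hU) hA hδ hm y)).trans_le (rmix_ge μ H hA hδ hm hU y)

theorem rmix_measurable (H : Matrix (Fin nr) (Fin nt) ℝ) (A δ m : ℝ) :
    Measurable (rmix μ H A δ m) :=
  Finset.measurable_fun_sum _ fun U _ => (rU_measurable H A δ m U).const_mul _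

theorem rmix_lintegral (H : Matrix (Fin nr) (Fin nt) ℝ) (hA : 0 < A) (hδ : 0 < δ) (hm : 0 < m)
    (hs : ∑ U ∈ GS H, pU μ H A U = 1) :
    ∫⁻ y, ENNReal.ofReal (rmix μ H A δ m y) ≤ 1 := by
  have h1 : ∀ y, ENNReal.ofReal (rmix μ H A δ m y) =
      ∑ U ∈ GS H, ENNReal.ofReal (pU μ H A U) * ENNReal.ofReal (rU H A δ m U y) := by
    intro y
    rw [rmix, ENNReal.ofReal_sum_of_nonneg fun U hU => mul_nonneg (pU_nonneg μ H A U)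
      (rU_pos H ((mem_GS H).1 hU) hA hδ hm y).le]
    exact Finset.sum_congr rfl fun U _ => ENNReal.ofReal_mul (pU_nonneg μ H A U)
  simp_rw [h1]
  have h2 : ∀ U ∈ GS H, Measurable fun y =>
      ENNReal.ofReal (pU μ H A U) * ENNReal.ofReal (rU H A δ m U y) := fun U _ =>
    (ENNReal.measurable_ofReal.comp (rU_measurable H A δ m U)).const_mul _
  rw [lintegral_finsetSum _ h2]
  calc _ ≤ ∑ U ∈ GS H, ENNReal.ofReal (pU μ H A U) := by
        refine Finset.sum_le_sum fun U hU => ?_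
        rw [lintegral_const_mul' _ _ ENNReal.ofReal_ne_top]
        exact mul_le_of_le_one_right' (rU_lintegral H ((mem_GS H).1 hU) hA hδ hm)
    _ = 1 := by
        rw [← ENNReal.ofReal_sum_of_nonneg fun U _ => pU_nonneg μ H A U, hs, ENNReal.ofReal_one]

theorem pointwise_bound (H : Matrix (Fin nr) (Fin nt) ℝ) (hA : 0 < A) (hδ : 0 < δ) (hm : 0 < m)
    (x : Fin nt → ℝ) (y : Fin nr → ℝ)
    (hw : ∑ U ∈ GS H, wU H A U x = 1)
    (h0 : ∀ U ∈ GS H, pU μ H A U = 0 → wU H A U x = 0) :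
    Real.log (npdf nr (y - H *ᵥ x)) - Real.log (rmix μ H A δ m y) ≤
      G0 μ H A δ m (x, y - H *ᵥ x) := by
  unfold G0
  rw [sub_eq_add_neg]
  gcongr
  calc -Real.log (rmix μ H A δ m y)
      = ∑ U ∈ GS H, wU H A U x * -Real.log (rmix μ H A δ m y) := by
        rw [← Finset.sum_mul, hw, one_mul]
    _ ≤ _ := by
        refine Finset.sum_le_sum fun U hU => ?_
        simp only [tm]
        rw [← Finset.mul_sum, ← mul_add]
        by_cases h : wU H A U x = 0
        · rw [h, zero_mul, zero_mul]
        · refine mul_le_mul_of_nonneg_left ?_ (wU_nonneg H A U x)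
          have hp : 0 < pU μ H A U :=
            (pU_nonneg μ H A U).lt_of_ne' fun hp => h (h0 U hU hp)
          have hr := rU_pos H ((mem_GS H).1 hU) hA hδ hm y
          have h1 := Real.log_le_log (mul_pos hp hr) (rmix_ge μ H hA hδ hm hU y)
          rw [Real.log_mul hp.ne' hr.ne'] at h1
          have h2 := neg_log_rU_le H ((mem_GS H).1 hU) hA hδ hm x y (wU_mem H A h)
          unfold cU
          linarith

theorem mi_bound (H : Matrix (Fin nr) (Fin nt) ℝ) (hrank : H.rank = nr) {α : ℝ}
    (hA : 0 < A) (hδ : 0 < δ) (hm : 0 < m)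
    (htie : ∀ U ∈ goodSets H, ∀ j ∉ U, aUj H U j ≠ 1)
    (hμ : ∀ᵐ x ∂μ, ∀ k, x k ∈ Set.Icc (0 : ℝ) A)
    (hpow : (∫ x, ∑ k, |x k| ∂μ) ≤ α * A) :
    mutualInfoJoint (jointLaw H μ) ≤ -(nr * Real.log (Real.sqrt (2 * Real.pi * Real.exp 1)))
      + ∑ U ∈ GS H, pU μ H A U * (cU μ H A U + ∑ l,
          (Real.log (Econst A δ m (sigmaUl H U l)) + Kb A δ m (sigmaUl H U l)))
      + m * (α - ∑ U ∈ GS H, pU μ H A U * sU H U) := by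
  have hs := pU_sum μ H hrank hA htie hμ
  have hcont : Continuous fun x : Fin nt → ℝ => H *ᵥ x := by fun_prop
  have hHm : Measurable fun x : Fin nt → ℝ => H *ᵥ x := hcont.measurable
  have hf : Measurable fun p : (Fin nt → ℝ) × (Fin nr → ℝ) => (p.1, H *ᵥ p.1 + p.2) := by fun_prop
  have hf2 : Measurable fun p : (Fin nt → ℝ) × (Fin nr → ℝ) => (p.1, p.2 - H *ᵥ p.1) := by
    fun_prop
  have hn := npdf_measurable nr
  have hk : Measurable fun p : (Fin nt → ℝ) × (Fin nr → ℝ) =>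
      ENNReal.ofReal (npdf nr (p.2 - H *ᵥ p.1)) := by
    refine ENNReal.measurable_ofReal.comp (hn.comp ?_)
    fun_prop
  have hGm : Measurable fun p : (Fin nt → ℝ) × (Fin nr → ℝ) =>
      G0 μ H A δ m (p.1, p.2 - H *ᵥ p.1) := (G0_measurable μ H A δ m).comp hf2
  have hcomp : ∀ p : (Fin nt → ℝ) × (Fin nr → ℝ),
      G0 μ H A δ m ((p.1, H *ᵥ p.1 + p.2).1, (p.1, H *ᵥ p.1 + p.2).2 -
        H *ᵥ (p.1, H *ᵥ p.1 + p.2).1) = G0 μ H A δ m p := by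
    intro p; simp
  have hGi : Integrable (fun p : (Fin nt → ℝ) × (Fin nr → ℝ) =>
      G0 μ H A δ m (p.1, p.2 - H *ᵥ p.1)) (jointLaw H μ) := by
    unfold jointLaw
    rw [integrable_map_measure hGm.aestronglyMeasurable hf.aemeasurable]
    refine (G0_integrable (δ := δ) μ H hA hm).congr (ae_of_all _ fun p => (hcomp p).symm)
  have hfst : (jointLaw H μ).map Prod.fst = μ := by
    unfold jointLaw
    rw [Measure.map_map measurable_fst hf]
    have : (Prod.fst ∘ fun p : (Fin nt → ℝ) × (Fin nr → ℝ) => (p.1, H *ᵥ p.1 + p.2)) =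
        Prod.fst := rfl
    rw [this, Measure.map_fst_prod]
    simp
  have hae : ∀ᵐ x ∂μ, ∑ U ∈ GS H, wU H A U x = 1 ∧
      ∀ U ∈ GS H, pU μ H A U = 0 → wU H A U x = 0 := by
    have h2 : ∀ U ∈ GS H, ∀ᵐ x ∂μ, pU μ H A U = 0 → wU H A U x = 0 := by
      intro U hU
      by_cases hp : pU μ H A U = 0
      · rw [pU_eq μ H A hU, integral_eq_zero_iff_of_nonneg (wU_nonneg H A U)
          (wU_integrable μ H A hU)] at hp
        filter_upwards [hp] with x hx _ using hx
      · exact ae_of_all _ fun x h => absurd h hp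
    have h3 := (ae_ball_iff (GS H).countable_toSet).2 h2
    filter_upwards [hμ, h3] with x hx hx3
    exact ⟨wU_sum H hrank hA htie x hx, fun U hU => hx3 U hU⟩
  have hdual := duality μ volume _ hk 1 ENNReal.one_ne_top
    (fun p => by
      rw [ENNReal.ofReal_le_one]
      exact npdf_le_one _)
    (fun p => (ENNReal.ofReal_pos.2 (npdf_pos _)).ne')
    (fun x => npdf_shift_lintegral (H *ᵥ x))
    (jointLaw H μ) (jointLaw_eq H μ)
    (fun y => ENNReal.ofReal (rmix μ H A δ m y))
    (ENNReal.measurable_ofReal.comp (rmix_measurable μ H A δ m))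
    (fun y => (ENNReal.ofReal_pos.2 (rmix_pos μ H hA hδ hm hs y)).ne')
    (fun y => ENNReal.ofReal_ne_top)
    (rmix_lintegral μ H hA hδ hm hs)
    _ hGi
    (by
      have h4 : ∀ᵐ p ∂(jointLaw H μ), ∑ U ∈ GS H, wU H A U p.1 = 1 ∧
          ∀ U ∈ GS H, pU μ H A U = 0 → wU H A U p.1 = 0 := by
        refine ae_of_ae_map (f := Prod.fst) (p := fun x => ∑ U ∈ GS H, wU H A U x = 1 ∧
          ∀ U ∈ GS H, pU μ H A U = 0 → wU H A U x = 0) measurable_fst.aemeasurable ?_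
        rw [hfst]
        exact hae
      filter_upwards [h4] with p hp
      rw [ENNReal.toReal_ofReal (npdf_pos _).le,
        ENNReal.toReal_ofReal (rmix_pos μ H hA hδ hm hs _).le]
      exact pointwise_bound μ H hA hδ hm p.1 p.2 hp.1 hp.2)
  refine hdual.trans ?_
  have hIntG : ∫ p, G0 μ H A δ m (p.1, p.2 - H *ᵥ p.1) ∂(jointLaw H μ) =
      ∫ p, G0 μ H A δ m p ∂(μ.prod (stdGaussian nr)) := by
    unfold jointLaw
    rw [integral_map hf.aemeasurable hGm.aestronglyMeasurable]
    exact integral_congr_ae (ae_of_all _ hcomp)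
  rw [hIntG]
  refine (G0_integral_le μ H hA hδ hm).trans ?_
  refine add_le_add le_rfl ?_
  have hpa := power_avg μ H hrank hA htie hμ hpow
  set S := ∑ U ∈ GS H, ∑ l, ∫ x, wU H A U x * lamU H A U x l ∂μ
  set P := ∑ U ∈ GS H, pU μ H A U * sU H U
  calc m / A * S ≤ m / A * (α * A - A * P) := by
        gcongr
        linarith
    _ = m * (α - P) := by field_simp

end MainBound

end MimoOptical

namespace MimoOptical

section FinalAlgebra

variable {nt nr : ℕ}

/-- The bound in the form of the statement. -/
def bnd (H : Matrix (Fin nr) (Fin nt) ℝ) (A α δ mu : ℝ) (p : Finset (Fin nt) → ℝ) : ℝ :=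
  Real.log (MimoOptical.VH H) - MimoOptical.Dkl H p (MimoOptical.qU H)
            + (∑ᶠ U ∈ MimoOptical.goodSets H, p U *
                ∑ ℓ, Real.log (A * (Real.exp (mu * δ / A)
                    - Real.exp (-(mu * (1 + δ / A))))
                  / (Real.sqrt (2 * Real.pi * Real.exp 1) * mu
                    * (1 - 2 * MimoOptical.Qf (δ / MimoOptical.sigmaUl H U ℓ)))))
            + (∑ᶠ U ∈ MimoOptical.goodSets H, p U *
                ∑ ℓ, MimoOptical.Qf (δ / MimoOptical.sigmaUl H U ℓ))
            + (∑ᶠ U ∈ MimoOptical.goodSets H, p U *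
                ∑ ℓ, δ / (Real.sqrt (2 * Real.pi) * MimoOptical.sigmaUl H U ℓ) *
                  Real.exp (-(δ ^ 2) / (2 * (MimoOptical.sigmaUl H U ℓ) ^ 2)))
            + mu / (A * Real.sqrt (2 * Real.pi)) *
                (∑ᶠ U ∈ MimoOptical.goodSets H, p U *
                  ∑ ℓ, MimoOptical.sigmaUl H U ℓ *
                    (Real.exp (-(δ ^ 2) / (2 * (MimoOptical.sigmaUl H U ℓ) ^ 2))
                      - Real.exp (-((A + δ) ^ 2)
                          / (2 * (MimoOptical.sigmaUl H U ℓ) ^ 2))))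
            + mu * (α - ∑ᶠ U ∈ MimoOptical.goodSets H, p U * MimoOptical.sU H U)

/-- The bound in compact form. -/
def bnd2 (H : Matrix (Fin nr) (Fin nt) ℝ) (A α δ m : ℝ) (p : Finset (Fin nt) → ℝ) : ℝ :=
  -(nr * Real.log (Real.sqrt (2 * Real.pi * Real.exp 1)))
      + ∑ U ∈ GS H, p U * (-Real.log (p U) + Real.log |(HU H U).det| + ∑ l,
          (Real.log (Econst A δ m (sigmaUl H U l)) + Kb A δ m (sigmaUl H U l)))
      + m * (α - ∑ U ∈ GS H, p U * sU H U)

theorem VH_pos (H : Matrix (Fin nr) (Fin nt) ℝ) {U : Finset (Fin nt)} (hU : U ∈ GS H) :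
    0 < VH H := by
  unfold VH
  rw [finsum_GS]
  exact (abs_pos.2 (HU_det_isUnit H ((mem_GS H).1 hU)).ne_zero).trans_le
    (Finset.single_le_sum (f := fun U => |(HU H U).det|) (fun _ _ => abs_nonneg _) hU)

theorem bnd_eq (H : Matrix (Fin nr) (Fin nt) ℝ) (p : Finset (Fin nt) → ℝ) (hp : ProbVec H p)
    {A α δ m : ℝ} (hA : 0 < A) (hδ : 0 < δ) (hm : 0 < m) :
    bnd H A α δ m p = bnd2 H A α δ m p := by
  unfold bnd bnd2 Dkl
  obtain ⟨hp0, -, hp1⟩ := hp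
  simp only [finsum_GS] at hp1 ⊢
  congr 1
  have h1 : Real.log (VH H) = ∑ U ∈ GS H, p U * Real.log (VH H) := by
    rw [← Finset.sum_mul, hp1, one_mul]
  have h2 : -((nr : ℝ) * Real.log (Real.sqrt (2 * Real.pi * Real.exp 1))) =
      ∑ U ∈ GS H, p U * ∑ _l : Fin nr, -Real.log (Real.sqrt (2 * Real.pi * Real.exp 1)) := by
    rw [← Finset.sum_mul, hp1, one_mul]
    simp
  rw [h1, h2, Finset.mul_sum]
  simp only [← Finset.sum_add_distrib, ← Finset.sum_sub_distrib]
  refine Finset.sum_congr rfl fun U hU => ?_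
  have hV := VH_pos H hU
  have hd : 0 < |(HU H U).det| := abs_pos.2 (HU_det_isUnit H ((mem_GS H).1 hU)).ne_zero
  have h3 : p U * Real.log (VH H) - p U * Real.log (p U / qU H U) =
      p U * (-Real.log (p U) + Real.log |(HU H U).det|) := by
    rcases (hp0 U).eq_or_lt with h | h
    · rw [← h]; ring
    · unfold qU
      rw [Real.log_div h.ne' (by positivity), Real.log_div hd.ne' hV.ne']
      ring
  rw [h3]
  have h4 : ∀ l : Fin nr, Real.log (A * (Real.exp (m * δ / A) - Real.exp (-(m * (1 + δ / A))))
      / (Real.sqrt (2 * Real.pi * Real.exp 1) * m * (1 - 2 * Qf (δ / sigmaUl H U l)))) =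
      -Real.log (Real.sqrt (2 * Real.pi * Real.exp 1))
        + Real.log (Econst A δ m (sigmaUl H U l)) := by
    intro l
    have hs : (0 : ℝ) < Real.sqrt (2 * Real.pi * Real.exp 1) := by positivity
    have hE := Econst_pos hA hδ hm (sigma_pos H ((mem_GS H).1 hU) l)
    have : A * (Real.exp (m * δ / A) - Real.exp (-(m * (1 + δ / A))))
      / (Real.sqrt (2 * Real.pi * Real.exp 1) * m * (1 - 2 * Qf (δ / sigmaUl H U l))) =
      Econst A δ m (sigmaUl H U l) / Real.sqrt (2 * Real.pi * Real.exp 1) := by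
      unfold Econst
      rw [div_div]
      congr 1
      ring
    rw [this, Real.log_div hE.ne' hs.ne']
    ring
  simp only [h4, Kb, Finset.sum_add_distrib, ← Finset.mul_sum]
  ring

/-- Uniform upper bound, used for boundedness of the supremum. -/
def Mbound (H : Matrix (Fin nr) (Fin nt) ℝ) (A α : ℝ) : ℝ :=
  |(nr : ℝ) * Real.log (Real.sqrt (2 * Real.pi * Real.exp 1))|
      + ∑ U ∈ GS H, (1 + |Real.log |(HU H U).det| + ∑ l,
          (Real.log (Econst A 1 1 (sigmaUl H U l)) + Kb A 1 1 (sigmaUl H U l))|)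
      + (|α| + ∑ U ∈ GS H, |sU H U|)

theorem Mbound_nonneg (H : Matrix (Fin nr) (Fin nt) ℝ) (A α : ℝ) : 0 ≤ Mbound H A α := by
  unfold Mbound
  positivity

theorem bnd_le (H : Matrix (Fin nr) (Fin nt) ℝ) (p : Finset (Fin nt) → ℝ) (hp : ProbVec H p)
    {A α : ℝ} : bnd2 H A α 1 1 p ≤ Mbound H A α := by
  obtain ⟨hp0, -, hp1⟩ := hp
  rw [finsum_GS] at hp1
  have hle : ∀ U ∈ GS H, p U ≤ 1 := fun U hU =>
    hp1 ▸ Finset.single_le_sum (f := p) (fun V _ => hp0 V) hU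
  have hmul : ∀ U ∈ GS H, ∀ t : ℝ, p U * t ≤ |t| := fun U hU t =>
    (mul_le_mul_of_nonneg_left (le_abs_self t) (hp0 U)).trans
      (mul_le_of_le_one_left (abs_nonneg t) (hle U hU))
  unfold bnd2 Mbound
  refine add_le_add (add_le_add (neg_le_abs _) (Finset.sum_le_sum fun U hU => ?_)) ?_
  · rw [add_assoc, mul_add]
    refine add_le_add ?_ (hmul U hU _)
    have h0 := hp0 U
    rcases h0.eq_or_lt with h | h
    · rw [← h]; simp
    · have h1 := Real.one_sub_inv_le_log_of_pos h
      have h2 := mul_le_mul_of_nonneg_left h1 h0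
      rw [mul_sub, mul_inv_cancel₀ h.ne'] at h2
      linarith
  · rw [one_mul, sub_eq_add_neg, ← Finset.sum_neg_distrib]
    refine add_le_add (le_abs_self _) (Finset.sum_le_sum fun U hU => ?_)
    have := hmul U hU (-sU H U)
    rw [abs_neg] at this
    linarith

theorem sInf_le_of_mem {S : Set ℝ} {M b : ℝ} (hM : 0 ≤ M) (hb : b ∈ S) (h : b ≤ M) :
    sInf S ≤ M := by
  by_cases hS : BddBelow S
  · exact (csInf_le hS hb).trans h
  · rw [Real.sInf_of_not_bddBelow hS]; exact hM

end FinalAlgebra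

end MimoOptical

/-- If `α < α_th`, then `C_H(A, αA) ≤ sup_p inf_{δ,μ>0} {…}` where the
supremum is over probability vectors `p` on `𝒰` with `Σ_U p_U s_U ≤ α`. -/
theorem MimoOptical.capacity_upper_bound_avg_two
    (nt nr : ℕ) (hnr : 1 ≤ nr) (hntnr : nr < nt)
    (H : Matrix (Fin nr) (Fin nt) ℝ) (hrank : H.rank = nr)
    (A α : ℝ) (hA : 0 < A) (hα : 0 < α)
    (htie : ∀ U ∈ MimoOptical.goodSets H, ∀ j ∉ U, MimoOptical.aUj H U j ≠ 1)
    (h : α < MimoOptical.alphaTh H) :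
    MimoOptical.capacity H A (α * A) ≤
      sSup { c | ∃ p : Finset (Fin nt) → ℝ, MimoOptical.ProbVec H p ∧
        (∑ᶠ U ∈ MimoOptical.goodSets H, p U * MimoOptical.sU H U) ≤ α ∧
        c = sInf { b | ∃ δ mu : ℝ, 0 < δ ∧ 0 < mu ∧
          b = Real.log (MimoOptical.VH H) - MimoOptical.Dkl H p (MimoOptical.qU H)
            + (∑ᶠ U ∈ MimoOptical.goodSets H, p U *
                ∑ ℓ, Real.log (A * (Real.exp (mu * δ / A)
                    - Real.exp (-(mu * (1 + δ / A))))
                  / (Real.sqrt (2 * Real.pi * Real.exp 1) * mu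
                    * (1 - 2 * MimoOptical.Qf (δ / MimoOptical.sigmaUl H U ℓ)))))
            + (∑ᶠ U ∈ MimoOptical.goodSets H, p U *
                ∑ ℓ, MimoOptical.Qf (δ / MimoOptical.sigmaUl H U ℓ))
            + (∑ᶠ U ∈ MimoOptical.goodSets H, p U *
                ∑ ℓ, δ / (Real.sqrt (2 * Real.pi) * MimoOptical.sigmaUl H U ℓ) *
                  Real.exp (-(δ ^ 2) / (2 * (MimoOptical.sigmaUl H U ℓ) ^ 2)))
            + mu / (A * Real.sqrt (2 * Real.pi)) *
                (∑ᶠ U ∈ MimoOptical.goodSets H, p U *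
                  ∑ ℓ, MimoOptical.sigmaUl H U ℓ *
                    (Real.exp (-(δ ^ 2) / (2 * (MimoOptical.sigmaUl H U ℓ) ^ 2))
                      - Real.exp (-((A + δ) ^ 2)
                          / (2 * (MimoOptical.sigmaUl H U ℓ) ^ 2))))
            + mu * (α - ∑ᶠ U ∈ MimoOptical.goodSets H, p U * MimoOptical.sU H U) } } := by
  classical
  have hprob0 : MimoOptical.Admissible nt A (α * A) (Measure.dirac 0) := by
    refine ⟨inferInstance, ?_, ?_⟩
    · rw [ae_dirac_eq]
      exact fun k => ⟨le_rfl, hA.le⟩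
    · rw [integral_dirac]
      simpa using (mul_pos hα hA).le
  refine csSup_le ⟨_, _, hprob0, rfl⟩ ?_
  rintro c ⟨μ, ⟨hpr, hμ, hpow⟩, rfl⟩
  have hpv := MimoOptical.pU_probVec μ H hrank hA htie hμ
  have hps : (∑ᶠ U ∈ MimoOptical.goodSets H, MimoOptical.pU μ H A U * MimoOptical.sU H U) ≤ α := by
    rw [MimoOptical.finsum_GS]
    have h1 := MimoOptical.power_avg μ H hrank hA htie hμ hpow
    have h2 := MimoOptical.lam_avg_nonneg μ H hA
    have h3 : A * ∑ U ∈ MimoOptical.GS H, MimoOptical.pU μ H A U * MimoOptical.sU H U ≤ A * α := by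
      linarith
    exact le_of_mul_le_mul_left h3 hA
  refine le_csSup_of_le ?_ ⟨MimoOptical.pU μ H A, hpv, hps, rfl⟩ ?_
  · refine ⟨MimoOptical.Mbound H A α, ?_⟩
    rintro c ⟨p, hp, -, rfl⟩
    refine MimoOptical.sInf_le_of_mem (MimoOptical.Mbound_nonneg H A α)
      ⟨1, 1, one_pos, one_pos, rfl⟩ ?_
    have := MimoOptical.bnd_eq H p hp hA one_pos one_pos (δ := 1) (m := 1) (α := α)
    rw [MimoOptical.bnd] at this
    rw [this]
    exact MimoOptical.bnd_le H p hp
  · refine le_csInf ⟨_, 1, 1, one_pos, one_pos, rfl⟩ ?_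
    rintro b ⟨δ, mu, hδ, hmu, rfl⟩
    have := MimoOptical.bnd_eq H (MimoOptical.pU μ H A) hpv hA hδ hmu (α := α)
    rw [MimoOptical.bnd] at this
    rw [this]
    exact MimoOptical.mi_bound μ H hrank hA hδ hmu htie hμ hpow
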